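/- arXiv:1807.00109 — 5 statements merged into one kernel-verified Lean document; each statement's English description precedes it below -/
import Mathlib

section
/- Let Γ be a group and (𝔾, s, t) ∈ 𝒟. Suppose there exist vertices x₁, x₂ ∈ V(𝔾)∖{s,t}, an s–x₁ path P₁ and an s–x₂ path P₂ in 𝔾 with ψ_𝔾(P₁) ≠ ψ_𝔾(P₂), and elements α', β' ∈ Γ with α'β'⁻¹ ≠ β'α'⁻¹ such that {α', β'} ⊆ l(𝔾 − (V(Pᵢ)∖{xᵢ}); xᵢ, t) for each i = 1, 2 (where 𝔾 − Y denotes the subgraph obtained by deleting the vertex set Y). Then |l(𝔾; s, t)| ≥ 3. -/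
/-- A Γ-labeled graph: a finite loopless directed multigraph with arcs labeled by
elements of a group Γ.  An arc is represented as a triple `(tail, head, label)`. -/
structure LGraph (V : Type) (Γ : Type) [Group Γ] where
  verts : Set V
  arcs : Set (V × V × Γ)
  verts_finite : verts.Finite
  arcs_finite : arcs.Finite
  tail_mem : ∀ a ∈ arcs, a.1 ∈ verts
  head_mem : ∀ a ∈ arcs, a.2.1 ∈ verts
  loopless : ∀ a ∈ arcs, a.1 ≠ a.2.1

namespace LGraph

variable {V : Type} {Γ : Type} [Group Γ]

/-- `connects a u v` : the arc `a` joins `u` and `v` (traversed from `u` to `v`,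
in either direction of the arc). -/
def connects (a : V × V × Γ) (u v : V) : Prop :=
  (a.1 = u ∧ a.2.1 = v) ∨ (a.1 = v ∧ a.2.1 = u)

/-- Walks in the underlying undirected graph of a Γ-labeled graph. -/
inductive Walk (G : LGraph V Γ) : V → V → Type
  | nil (v : V) : Walk G v v
  | cons (u v : V) {w : V} (a : V × V × Γ) (ha : a ∈ G.arcs)
      (hstep : connects a u v) (W : Walk G v w) : Walk G u w

variable [DecidableEq V]

/-- `ψ_𝔾(e, v)` : the label contributed by arc `a` when traversed arriving at `v` :
the arc's label if the arc enters `v`, its inverse if it leaves `v`. -/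
def stepLabel (v : V) (a : V × V × Γ) : Γ :=
  if a.2.1 = v then a.2.2 else a.2.2⁻¹

namespace Walk

variable {G : LGraph V Γ}

/-- The label `ψ_𝔾(W)` of a walk: the product of the step labels, later steps
multiplied on the left. -/
def label : {u w : V} → G.Walk u w → Γ
  | _, _, .nil _ => 1
  | _, _, .cons _ v a _ _ W => label W * stepLabel v a

/-- The list of vertices of a walk, in order. -/
def support : {u w : V} → G.Walk u w → List V
  | _, _, .nil v => [v]
  | _, _, .cons u _ _ _ _ W => u :: support W

/-- The list of traversed arcs of a walk, in order. -/
def arcsList : {u w : V} → G.Walk u w → List (V × V × Γ)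
  | _, _, .nil _ => []
  | _, _, .cons _ _ a _ _ W => a :: arcsList W

/-- The length (number of edges) of a walk. -/
def length : {u w : V} → G.Walk u w → ℕ
  | _, _, .nil _ => 0
  | _, _, .cons _ _ _ _ _ W => length W + 1

/-- A walk is a path if all its vertices are distinct. -/
def IsPath {u w : V} (W : G.Walk u w) : Prop := W.support.Nodup

/-- A closed walk is a cycle if it is nonempty, its edges are distinct and its
vertices (except for the repeated end vertex) are distinct. -/
def IsCycle {v : V} (W : G.Walk v v) : Prop :=
  1 ≤ W.length ∧ W.arcsList.Nodup ∧ W.support.dropLast.Nodup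

end Walk

/-- `l(𝔾; s, t)` : the set of all labels of s–t paths in `G`. -/
def labelSet (G : LGraph V Γ) (s t : V) : Set Γ :=
  {γ | ∃ P : G.Walk s t, P.IsPath ∧ P.label = γ}

/-- A Γ-labeled graph is balanced if every cycle has label `1`. -/
def Balanced (G : LGraph V Γ) : Prop :=
  ∀ (v : V) (C : G.Walk v v), C.IsCycle → C.label = 1

/-- Connectivity of (the underlying graph of) a Γ-labeled graph. -/
def Connected (G : LGraph V Γ) : Prop :=
  ∀ u ∈ G.verts, ∀ w ∈ G.verts, Nonempty (G.Walk u w)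

/-- `G` has no pair of equivalent arcs: no two distinct arcs that are parallel with
the same label, or antiparallel with mutually inverse labels. -/
def NoEquivArcs (G : LGraph V Γ) : Prop :=
  ∀ a ∈ G.arcs, ∀ b ∈ G.arcs, a ≠ b →
    ¬ ((a.1 = b.1 ∧ a.2.1 = b.2.1 ∧ a.2.2 = b.2.2) ∨
       (a.1 = b.2.1 ∧ a.2.1 = b.1 ∧ a.2.2 = b.2.2⁻¹))

/-- `(𝔾, s, t) ∈ 𝒟` : `s, t` are distinct vertices, every vertex lies on some
s–t path, and there are no equivalent arcs. -/
def MemD (G : LGraph V Γ) (s t : V) : Prop :=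
  s ≠ t ∧ s ∈ G.verts ∧ t ∈ G.verts ∧
  (∀ v ∈ G.verts, ∃ P : G.Walk s t, P.IsPath ∧ v ∈ P.support) ∧
  G.NoEquivArcs

/-- `(s,t)`-equivalence: `H` is obtained from `G` by shifting by `φ v` at each
vertex `v`, where `φ` vanishes at `s` and `t`. -/
def STEquiv (s t : V) (G H : LGraph V Γ) : Prop :=
  ∃ φ : V → Γ, φ s = 1 ∧ φ t = 1 ∧ H.verts = G.verts ∧
    H.arcs = (fun a : V × V × Γ => (a.1, a.2.1, φ a.2.1 * a.2.2 * (φ a.1)⁻¹)) '' G.arcs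

/-- The subgraph induced by a vertex set `X`. -/
def induce (G : LGraph V Γ) (X : Set V) : LGraph V Γ where
  verts := G.verts ∩ X
  arcs := {a ∈ G.arcs | a.1 ∈ X ∧ a.2.1 ∈ X}
  verts_finite := G.verts_finite.subset Set.inter_subset_left
  arcs_finite := G.arcs_finite.subset fun _ ha => ha.1
  tail_mem := fun a ha => ⟨G.tail_mem a ha.1, ha.2.1⟩
  head_mem := fun a ha => ⟨G.head_mem a ha.1, ha.2.2⟩
  loopless := fun a ha => G.loopless a ha.1

/-- `𝔾 − Y` : deletion of the vertex set `Y`. -/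
def delete (G : LGraph V Γ) (Y : Set V) : LGraph V Γ := G.induce Yᶜ

/-- `N_𝔾(X)` : the set of vertices outside `X` adjacent to `X`. -/
def nbhd (G : LGraph V Γ) (X : Set V) : Set V :=
  {y | y ∉ X ∧ ∃ x ∈ X, ∃ a ∈ G.arcs, connects a x y}

/-- `𝔾⟦X⟧` : the subgraph induced by `X ∪ N(X)` with the edges inside `N(X)` removed. -/
def around (G : LGraph V Γ) (X : Set V) : LGraph V Γ where
  verts := G.verts ∩ (X ∪ G.nbhd X)
  arcs := {a ∈ G.arcs | (a.1 ∈ X ∪ G.nbhd X) ∧ (a.2.1 ∈ X ∪ G.nbhd X) ∧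
            ¬ (a.1 ∈ G.nbhd X ∧ a.2.1 ∈ G.nbhd X)}
  verts_finite := G.verts_finite.subset Set.inter_subset_left
  arcs_finite := G.arcs_finite.subset fun _ ha => ha.1
  tail_mem := fun a ha => ⟨G.tail_mem a ha.1, ha.2.1⟩
  head_mem := fun a ha => ⟨G.head_mem a ha.1, ha.2.2.1⟩
  loopless := fun a ha => G.loopless a ha.1

/-- The arcs of `G` surviving the removal of the vertex set `X`. -/
def keptArcs (G : LGraph V Γ) (X : Set V) : Set (V × V × Γ) :=
  {a ∈ G.arcs | a.1 ∉ X ∧ a.2.1 ∉ X}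

/-- `A` contains an arc equivalent to an arc from `x` to `y` with label `γ`. -/
def hasEquivArc (A : Set (V × V × Γ)) (x y : V) (γ : Γ) : Prop :=
  (x, y, γ) ∈ A ∨ (y, x, γ⁻¹) ∈ A

/-- The new arcs added by a contraction of `X`, between `x` and `y`: an arc from `x`
to `y` with label `γ` for each `γ ∈ l(𝔾⟦X⟧; x, y)`, unless an equivalent arc
already exists among the kept arcs. -/
def newContractionArcs (G : LGraph V Γ) (X : Set V) (x y : V) : Set (V × V × Γ) :=
  {p | ∃ γ ∈ labelSet (G.around X) x y, p = (x, y, γ) ∧ ¬ hasEquivArc (G.keptArcs X) x y γ}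

/-- The arc set of the 2-contraction `𝔾 /₂ X`, where `N_𝔾(X) = {x, y}`. -/
def contract2Arcs (G : LGraph V Γ) (X : Set V) (x y : V) : Set (V × V × Γ) :=
  G.keptArcs X ∪ G.newContractionArcs X x y

/-- The arc set of the 3-contraction `𝔾 /₃ X`, where `N_𝔾(X) = {x, y, z}`. -/
def contract3Arcs (G : LGraph V Γ) (X : Set V) (x y z : V) : Set (V × V × Γ) :=
  G.keptArcs X ∪ G.newContractionArcs X x y ∪ G.newContractionArcs X y z ∪
    G.newContractionArcs X x z

/-- `X` is 2-contractible in `𝔾` (w.r.t. the terminals `s, t`). -/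
def TwoContractible (G : LGraph V Γ) (s t : V) (X : Set V) : Prop :=
  X ⊆ G.verts \ {s, t} ∧
  (∃ x y : V, x ≠ y ∧ G.nbhd X = {x, y}) ∧
  (G.around X).Connected ∧ G.around X ≠ G

/-- `X` is 3-contractible in `𝔾` (w.r.t. the terminals `s, t`). -/
def ThreeContractible (G : LGraph V Γ) (s t : V) (X : Set V) : Prop :=
  X ⊆ G.verts \ {s, t} ∧
  (∃ x y z : V, x ≠ y ∧ x ≠ z ∧ y ≠ z ∧ G.nbhd X = {x, y, z}) ∧
  (G.induce X).Connected ∧ (G.around X).Balanced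

/-- The graph obtained by adding a single `s`–`t` edge (with an arbitrary label). -/
def addEdge (G : LGraph V Γ) (s t : V) (hs : s ∈ G.verts) (ht : t ∈ G.verts)
    (hst : s ≠ t) : LGraph V Γ where
  verts := G.verts
  arcs := insert (s, t, (1 : Γ)) G.arcs
  verts_finite := G.verts_finite
  arcs_finite := G.arcs_finite.insert _
  tail_mem := by
    intro a ha
    rcases Set.mem_insert_iff.mp ha with rfl | h
    · exact hs
    · exact G.tail_mem a h
  head_mem := by
    intro a ha
    rcases Set.mem_insert_iff.mp ha with rfl | h
    · exact ht
    · exact G.head_mem a h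
  loopless := by
    intro a ha
    rcases Set.mem_insert_iff.mp ha with rfl | h
    · exact hst
    · exact G.loopless a h

/-- 2-connectivity: more than 2 vertices, and removing any single vertex leaves
the graph connected. -/
def TwoConnected (G : LGraph V Γ) : Prop :=
  2 < G.verts.ncard ∧ ∀ v : V, (G.delete {v}).Connected

/-- The effect of shifting by `α` at `v` on a single arc. -/
def shiftArc (v : V) (α : Γ) (a : V × V × Γ) : V × V × Γ :=
  (a.1, a.2.1, if a.2.1 = v then α * a.2.2 else if a.1 = v then a.2.2 * α⁻¹ else a.2.2)

/-- The graph obtained from `G` by shifting by `α` at `v`. -/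
def shift (G : LGraph V Γ) (v : V) (α : Γ) : LGraph V Γ where
  verts := G.verts
  arcs := shiftArc v α '' G.arcs
  verts_finite := G.verts_finite
  arcs_finite := G.arcs_finite.image _
  tail_mem := by rintro a ⟨b, hb, rfl⟩; exact G.tail_mem b hb
  head_mem := by rintro a ⟨b, hb, rfl⟩; exact G.head_mem b hb
  loopless := by rintro a ⟨b, hb, rfl⟩; exact G.loopless b hb

/-- The walk in `G.shift v α` corresponding to a walk in `G`. -/
def Walk.shiftMap {G : LGraph V Γ} (v : V) (α : Γ) :
    {u w : V} → G.Walk u w → (G.shift v α).Walk u w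
  | _, _, .nil x => .nil x
  | _, _, .cons u x a ha hstep W =>
      .cons u x (shiftArc v α a) (Set.mem_image_of_mem _ ha) hstep (Walk.shiftMap v α W)

end LGraph

namespace LGraph

variable {V Γ : Type} [Group Γ]

namespace Walk

/-- Concatenation of walks. -/
def append {G : LGraph V Γ} : {u v w : V} → G.Walk u v → G.Walk v w → G.Walk u w
  | _, _, _, .nil _, Q => Q
  | _, _, _, .cons u x a ha h P, Q => .cons u x a ha h (append P Q)

/-- A walk of the graph with a vertex set deleted, seen in the original graph. -/
def ofDelete {G : LGraph V Γ} {Y : Set V} : {u w : V} → (G.delete Y).Walk u w → G.Walk u w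
  | _, _, .nil v => .nil v
  | _, _, .cons u x a ha h P => .cons u x a ha.1 h (ofDelete P)

variable {G : LGraph V Γ} {Y : Set V}

theorem label_append [DecidableEq V] {u v w : V} (P : G.Walk u v) (Q : G.Walk v w) :
    (P.append Q).label = Q.label * P.label := by
  induction P with
  | nil => simp [append, label]
  | cons u x a ha h P ih => simp [append, label, ih, mul_assoc]

theorem start_mem_support {u w : V} (P : G.Walk u w) : u ∈ P.support := by
  cases P <;> simp [support]

theorem mem_support_append {u v w y : V} (P : G.Walk u v) (Q : G.Walk v w) :
    y ∈ (P.append Q).support ↔ y ∈ P.support ∨ y ∈ Q.support := by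
  induction P with
  | nil v =>
    simp only [append, support, List.mem_singleton, iff_or_self]
    rintro rfl
    exact Q.start_mem_support
  | cons u x a ha h P ih => simp [append, support, ih, or_assoc]

theorem end_mem_support {u w : V} (P : G.Walk u w) : w ∈ P.support := by
  induction P with
  | nil => simp [support]
  | cons u x a ha h P ih => simp [support, ih]

theorem IsPath.append {u v w : V} {P : G.Walk u v} {Q : G.Walk v w} (hP : P.IsPath)
    (hQ : Q.IsPath) (hPQ : ∀ y ∈ P.support, y ∈ Q.support → y = v) :
    (P.append Q).IsPath := by
  induction P with
  | nil => exact hQ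
  | cons u x a ha h P ih =>
    obtain ⟨hu, hP⟩ := List.nodup_cons.mp hP
    refine List.nodup_cons.mpr ⟨fun hmem => ?_, ih hP hQ fun y hy =>
      hPQ y (List.mem_cons_of_mem _ hy)⟩
    rcases (mem_support_append P Q).mp hmem with hmem | hmem
    · exact hu hmem
    · exact hu (hPQ u List.mem_cons_self hmem ▸ P.end_mem_support)

theorem label_ofDelete [DecidableEq V] {u w : V} (P : (G.delete Y).Walk u w) :
    P.ofDelete.label = P.label := by
  induction P with
  | nil => rfl
  | cons u x a ha h P ih => simp [ofDelete, label, ih]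

theorem support_ofDelete {u w : V} (P : (G.delete Y).Walk u w) :
    P.ofDelete.support = P.support := by
  induction P with
  | nil => rfl
  | cons u x a ha h P ih => simp [ofDelete, support, ih]

theorem notMem_of_mem_support_delete {u w : V} (P : (G.delete Y).Walk u w) (hu : u ∉ Y) :
    ∀ y ∈ P.support, y ∉ Y := by
  induction P with
  | nil => simpa [support] using hu
  | cons u x a ha h P ih =>
    have hx : x ∉ Y := by
      rcases h with ⟨-, rfl⟩ | ⟨rfl, -⟩
      · exact ha.2.2
      · exact ha.2.1
    simpa [support, hu] using ih hx

end Walk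

/-- Extending a path `P` by a path avoiding the other vertices of `P`. -/
theorem mul_label_mem_labelSet [DecidableEq V] {G : LGraph V Γ} {s x t : V} {P : G.Walk s x}
    (hP : P.IsPath) {γ : Γ}
    (hγ : γ ∈ labelSet (G.delete ({v | v ∈ P.support} \ {x})) x t) :
    γ * P.label ∈ labelSet G s t := by
  obtain ⟨Q, hQ, rfl⟩ := hγ
  refine ⟨P.append Q.ofDelete, hP.append ?_ fun y hyP hyQ => ?_, ?_⟩
  · rwa [Walk.IsPath, Walk.support_ofDelete]
  · rw [Walk.support_ofDelete] at hyQ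
    by_contra hyx
    exact Q.notMem_of_mem_support_delete (by simp) y hyQ ⟨hyP, hyx⟩
  · rw [Walk.label_append, Walk.label_ofDelete]

end LGraph

/-- If `α`, `β` swap roles on `g` and `h`, then `α * β⁻¹` is its own inverse. -/
theorem mul_inv_eq_mul_inv_of_crossed {Γ : Type*} [Group Γ] {α β g h : Γ}
    (h₁ : α * h = β * g) (h₂ : β * h = α * g) : α * β⁻¹ = β * α⁻¹ := by
  have hα : β⁻¹ * α = g * h⁻¹ := by
    rw [eq_mul_inv_iff_mul_eq, mul_assoc, h₁, inv_mul_cancel_left]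
  have hβ : α⁻¹ * β = g * h⁻¹ := by
    rw [eq_mul_inv_iff_mul_eq, mul_assoc, h₂, inv_mul_cancel_left]
  calc α * β⁻¹ = β * (β⁻¹ * α) * β⁻¹ := by group
    _ = β * α⁻¹ := by rw [hα, ← hβ]; group

open LGraph in
/-- If `(G, s, t) ∈ 𝒟` admits two paths `P₁ : s–x₁`, `P₂ : s–x₂`
(`x₁, x₂ ∉ {s, t}`) of distinct labels, and elements `α', β'` with
`α'β'⁻¹ ≠ β'α'⁻¹` such that `{α', β'} ⊆ l(G − (V(Pᵢ)∖{xᵢ}); xᵢ, t)` for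
`i = 1, 2`, then `|l(G; s, t)| ≥ 3`. -/
theorem three_labels_of_two_two {V Γ : Type} [Group Γ] [DecidableEq V]
    (G : LGraph V Γ) (s t : V) (hD : G.MemD s t)
    (x₁ x₂ : V)
    (hx₁v : x₁ ∈ G.verts) (hx₂v : x₂ ∈ G.verts)
    (hx₁s : x₁ ≠ s) (hx₁t : x₁ ≠ t) (hx₂s : x₂ ≠ s) (hx₂t : x₂ ≠ t)
    (P₁ : G.Walk s x₁) (P₂ : G.Walk s x₂)
    (hP₁ : P₁.IsPath) (hP₂ : P₂.IsPath)
    (hlab : P₁.label ≠ P₂.label)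
    (α' β' : Γ) (hcomm : α' * β'⁻¹ ≠ β' * α'⁻¹)
    (h1 : {α', β'} ⊆ labelSet (G.delete ({v | v ∈ P₁.support} \ {x₁})) x₁ t)
    (h2 : {α', β'} ⊆ labelSet (G.delete ({v | v ∈ P₂.support} \ {x₂})) x₂ t) :
    ∃ γ₁ γ₂ γ₃ : Γ, γ₁ ∈ labelSet G s t ∧ γ₂ ∈ labelSet G s t ∧
      γ₃ ∈ labelSet G s t ∧ γ₁ ≠ γ₂ ∧ γ₁ ≠ γ₃ ∧ γ₂ ≠ γ₃ := by
  have a₁ := mul_label_mem_labelSet hP₁ (h1 (by simp : α' ∈ _))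
  have b₁ := mul_label_mem_labelSet hP₁ (h1 (by simp : β' ∈ _))
  have a₂ := mul_label_mem_labelSet hP₂ (h2 (by simp : α' ∈ _))
  have b₂ := mul_label_mem_labelSet hP₂ (h2 (by simp : β' ∈ _))
  have hne : α' ≠ β' := by
    rintro rfl
    exact hcomm rfl
  by_cases h : α' * P₂.label = β' * P₁.label
  · refine ⟨_, _, _, a₁, b₁, b₂, by simpa using hne, fun h' => hcomm ?_, by simpa using hlab⟩
    exact mul_inv_eq_mul_inv_of_crossed h h'.symm
  · exact ⟨_, _, _, a₁, b₁, a₂, by simpa using hne, by simpa using hlab, fun h' => h h'.symm⟩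
end

section
/- Let Γ be a group and let (𝔾, s, t) ∈ 𝒟 be such that 𝔾 contains no 2-contractible vertex set and no 3-contractible vertex set. Let X ⊆ V(𝔾)∖{s,t} be a vertex set with N_𝔾(X) = {x, y, z} for distinct vertices x, y, z such that the induced subgraph 𝔾[X] is connected. Then (𝔾⟦X⟧ − x, y, z) ∈ 𝒟, (𝔾⟦X⟧ − y, z, x) ∈ 𝒟, and (𝔾⟦X⟧ − z, x, y) ∈ 𝒟. -/
namespace SimpleGraph.Walk

variable {V : Type*} {H : SimpleGraph V}

theorem isPath_append_iff {u v w : V} (p : H.Walk u v) (q : H.Walk v w) :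
    (p.append q).IsPath ↔
      p.IsPath ∧ q.IsPath ∧ ∀ a ∈ p.support, a ∈ q.support → a = v := by
  rw [isPath_def, isPath_def, isPath_def, support_append, List.nodup_append,
    ← cons_tail_support q, List.tail_cons, List.nodup_cons]
  have hv := p.end_mem_support
  constructor
  · rintro ⟨hp, hq, hd⟩
    refine ⟨hp, ⟨fun h => hd v hv v h rfl, hq⟩, fun a ha haq => ?_⟩
    rcases List.mem_cons.mp haq with h | h
    · exact h
    · exact (hd a ha a h rfl).elim
  · rintro ⟨hp, ⟨hv', hq⟩, hd⟩
    refine ⟨hp, hq, fun a ha b hb hab => ?_⟩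
    subst hab
    exact hv' (hd a ha (List.mem_cons_of_mem _ hb) ▸ hb)

/-- Truncating a path at its first vertex in `S`. -/
theorem IsPath.exists_isPath_to_first_mem {S : Set V} {u e : V} {R : H.Walk u e} (hR : R.IsPath)
    (he : e ∈ S) :
    ∃ p ∈ S, ∃ R' : H.Walk u p, R'.IsPath ∧ R'.support ⊆ R.support ∧
      ∀ a ∈ R'.support, a ∈ S → a = p := by
  induction R with
  | nil => exact ⟨_, he, .nil, by simp, by simp, by simp⟩
  | @cons u v w h R ih =>
    by_cases hu : u ∈ S
    · exact ⟨u, hu, .nil, by simp, by simp, by simp⟩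
    · rw [cons_isPath_iff] at hR
      obtain ⟨p, hp, R', hR', hsub, hfirst⟩ := ih hR.1 he
      refine ⟨p, hp, .cons h R', ?_, ?_, ?_⟩
      · rw [cons_isPath_iff]
        exact ⟨hR', fun h' => hR.2 (hsub h')⟩
      · exact List.cons_subset_cons u hsub
      · intro a ha haS
        rw [support_cons, List.mem_cons] at ha
        rcases ha with rfl | ha
        · exact absurd haS hu
        · exact hfirst a ha haS

/-- Rerouting a path along an ear whose end vertices occur in the given order. -/
theorem exists_isPath_of_ordered_ear {y z a p : V} {P₁ : H.Walk y a} {P₂ : H.Walk a p}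
    {P₃ : H.Walk p z} (hP : (P₁.append (P₂.append P₃)).IsPath) {W : H.Walk a p} (hW : W.IsPath)
    (hap : a ≠ p)
    (hWP : ∀ u ∈ W.support, u ∈ (P₁.append (P₂.append P₃)).support → u = a ∨ u = p) :
    ∃ P' : H.Walk y z, P'.IsPath ∧ W.support ⊆ P'.support := by
  refine ⟨P₁.append (W.append P₃), ?_, fun u hu => by simp [mem_support_append_iff, hu]⟩
  simp only [isPath_append_iff, mem_support_append_iff] at hP hWP ⊢
  obtain ⟨h₁, ⟨-, h₃, h₂₃⟩, h₁₂⟩ := hP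
  have ha : a ∉ P₃.support := fun h => hap (h₂₃ a P₂.start_mem_support h)
  have hp : p ∉ P₁.support := fun h => hap (h₁₂ p h (.inl P₂.end_mem_support)).symm
  refine ⟨h₁, ⟨hW, h₃, fun u hu hu₃ => ?_⟩, fun u hu₁ hu => ?_⟩
  · exact (hWP u hu (.inr (.inr hu₃))).resolve_left fun h => ha (h ▸ hu₃)
  · rcases hu with hu | hu
    · exact (hWP u hu (.inl hu₁)).resolve_right fun h => hp (h ▸ hu₁)
    · exact h₁₂ u hu₁ (.inr hu)

/-- Rerouting a path along an ear. -/
theorem IsPath.exists_isPath_of_ear {y z a p : V} {P : H.Walk y z} (hP : P.IsPath)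
    (ha : a ∈ P.support) (hp : p ∈ P.support) {W : H.Walk a p} (hW : W.IsPath) (hap : a ≠ p)
    (hWP : ∀ u ∈ W.support, u ∈ P.support → u = a ∨ u = p) :
    ∃ P' : H.Walk y z, P'.IsPath ∧ W.support ⊆ P'.support := by
  obtain ⟨P₁, P₂, rfl⟩ := Walk.mem_support_iff_exists_append.mp ha
  rcases (mem_support_append_iff _ _).mp hp with h | h
  · obtain ⟨Q₁, Q₂, rfl⟩ := Walk.mem_support_iff_exists_append.mp h
    rw [← append_assoc] at hP hWP
    obtain ⟨P', hP', hsub⟩ := exists_isPath_of_ordered_ear hP hW.reverse hap.symm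
      fun u hu hu' => (hWP u (by simpa using hu) hu').symm
    exact ⟨P', hP', fun u hu => hsub (by simpa using hu)⟩
  · obtain ⟨Q₁, Q₂, rfl⟩ := Walk.mem_support_iff_exists_append.mp h
    exact exists_isPath_of_ordered_ear hP hW hap hWP

theorem reachable_of_adj_imp {H' : SimpleGraph V} {u w : V} (W : H.Walk u w)
    (h : ∀ a ∈ W.support, ∀ b ∈ W.support, H.Adj a b → H'.Adj a b) : H'.Reachable u w := by
  induction W with
  | nil => exact .rfl
  | cons hadj W ih =>
    refine (h _ (by simp) _ (by simp) hadj).reachable.trans (ih fun a ha b hb => ?_)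
    exact h a (List.mem_cons_of_mem _ ha) b (List.mem_cons_of_mem _ hb)

end SimpleGraph.Walk

namespace SimpleGraph

variable {V : Type*} (H : SimpleGraph V)

/-- The vertices lying on some `y`–`z` path. -/
def onPath (y z : V) : Set V := {u | ∃ P : H.Walk y z, P.IsPath ∧ u ∈ P.support}

/-- The vertices reachable from `v` without meeting `T`. -/
def reachAvoiding (T : Set V) (v : V) : Set V := {u | ∃ W : H.Walk v u, ∀ w ∈ W.support, w ∉ T}

variable {H}

theorem mem_reachAvoiding_of_mem_support {T : Set V} {v u w : V} {W : H.Walk v u}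
    (hW : ∀ a ∈ W.support, a ∉ T) (hw : w ∈ W.support) : w ∈ H.reachAvoiding T v := by
  obtain ⟨W₁, W₂, rfl⟩ := Walk.mem_support_iff_exists_append.mp hw
  exact ⟨W₁, fun a ha => hW a (by simp [Walk.mem_support_append_iff, ha])⟩

theorem notMem_of_mem_reachAvoiding {T : Set V} {v u : V} (hu : u ∈ H.reachAvoiding T v) :
    u ∉ T := by
  obtain ⟨W, hW⟩ := hu
  exact hW u W.end_mem_support

theorem mem_reachAvoiding_of_adj {T : Set V} {v u w : V} (hu : u ∈ H.reachAvoiding T v)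
    (h : H.Adj u w) (hw : w ∉ T) : w ∈ H.reachAvoiding T v := by
  obtain ⟨W, hW⟩ := hu
  refine ⟨W.concat h, fun a ha => ?_⟩
  rw [Walk.support_concat] at ha
  rcases List.mem_append.mp ha with ha | ha
  · exact hW a ha
  · rw [List.mem_singleton.mp ha]
    exact hw

/-- Two vertices of `reachAvoiding` are joined by a path inside it. -/
theorem exists_isPath_in_reachAvoiding {T : Set V} {v c d : V}
    (hc : c ∈ H.reachAvoiding T v) (hd : d ∈ H.reachAvoiding T v) :
    ∃ W : H.Walk c d, W.IsPath ∧ ∀ a ∈ W.support, a ∈ H.reachAvoiding T v := by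
  classical
  obtain ⟨W₁, h₁⟩ := hc
  obtain ⟨W₂, h₂⟩ := hd
  refine ⟨(W₁.reverse.append W₂).bypass, Walk.bypass_isPath _, fun a ha => ?_⟩
  have ha' := Walk.support_bypass_subset_support _ ha
  rw [Walk.mem_support_append_iff, Walk.support_reverse, List.mem_reverse] at ha'
  rcases ha' with h | h
  · exact mem_reachAvoiding_of_mem_support h₁ h
  · exact mem_reachAvoiding_of_mem_support h₂ h

/-- A component of the vertices lying on no `y`–`z` path attaches to at most one vertex that
does lie on such a path. -/
theorem eq_of_adj_reachAvoiding_onPath {y z v a b c d : V}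
    (ha : a ∈ H.onPath y z) (hb : b ∈ H.onPath y z)
    (hc : c ∈ H.reachAvoiding (H.onPath y z) v) (hd : d ∈ H.reachAvoiding (H.onPath y z) v)
    (hac : H.Adj a c) (hdb : H.Adj d b) : a = b := by
  by_contra hab
  obtain ⟨W, hW, hWC⟩ := exists_isPath_in_reachAvoiding hc hd
  have hWT : ∀ u ∈ W.support, u ∉ H.onPath y z :=
    fun u hu => notMem_of_mem_reachAvoiding (hWC u hu)
  obtain ⟨P, hP, haP⟩ := ha
  have hPT : ∀ u ∈ P.support, u ∈ H.onPath y z := fun u hu => ⟨P, hP, hu⟩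
  have key : ∃ e ∈ P.support, ∃ R : H.Walk b e, R.IsPath ∧ a ∉ R.support ∧
      ∀ u ∈ R.support, u ∈ H.onPath y z := by
    obtain ⟨Q, hQ, hbQ⟩ := hb
    have hQT : ∀ u ∈ Q.support, u ∈ H.onPath y z := fun u hu => ⟨Q, hQ, hu⟩
    obtain ⟨Q₁, Q₂, rfl⟩ := Walk.mem_support_iff_exists_append.mp hbQ
    rw [Walk.isPath_append_iff] at hQ
    simp only [Walk.mem_support_append_iff] at hQT
    by_cases h : a ∈ Q₁.support
    · exact ⟨z, P.end_mem_support, Q₂, hQ.2.1, fun h' => hab (hQ.2.2 a h h'),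
        fun u hu => hQT u (.inr hu)⟩
    · exact ⟨y, P.start_mem_support, Q₁.reverse, hQ.1.reverse, by simpa using h,
        fun u hu => hQT u (.inl (by simpa using hu))⟩
  obtain ⟨e, heP, R, hR, haR, hRT⟩ := key
  obtain ⟨p, hpP, R', hR', hsub, hfirst⟩ :=
    hR.exists_isPath_to_first_mem (S := {u | u ∈ P.support}) heP
  have haR' : a ∉ R'.support := fun h => haR (hsub h)
  have hap : a ≠ p := fun h => haR' (h ▸ R'.end_mem_support)
  have hear : (Walk.cons hac (W.append (Walk.cons hdb R'))).IsPath := by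
    rw [Walk.cons_isPath_iff, Walk.isPath_append_iff, Walk.cons_isPath_iff]
    simp only [Walk.mem_support_append_iff, Walk.support_cons, List.mem_cons, not_or]
    refine ⟨⟨hW, ⟨hR', fun h => ?_⟩, fun u hu hu' => ?_⟩, fun h => ?_, fun h => ?_, haR'⟩
    · exact hWT d W.end_mem_support (hRT d (hsub h))
    · exact hu'.resolve_right fun h => hWT u hu (hRT u (hsub h))
    · exact hWT a h (hPT a haP)
    · exact hWT d W.end_mem_support (h ▸ hPT a haP)
  obtain ⟨P', hP', hsub'⟩ := hP.exists_isPath_of_ear haP hpP hear hap fun u hu huP => by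
    simp only [Walk.mem_support_append_iff, Walk.support_cons, List.mem_cons] at hu
    rcases hu with h | h | h | h
    · exact .inl h
    · exact (hWT u h (hPT u huP)).elim
    · exact (hWT d W.end_mem_support (h ▸ hPT u huP)).elim
    · exact .inr (hfirst u h huP)
  exact hWT c W.start_mem_support ⟨P', hP', hsub' (by simp)⟩

end SimpleGraph

namespace LGraph

variable {V Γ : Type} [Group Γ]

/-- The simple graph underlying a labeled graph. -/
def toSimple (G : LGraph V Γ) : SimpleGraph V where
  Adj u v := ∃ a ∈ G.arcs, connects a u v
  symm := ⟨fun _ _ ⟨a, ha, h⟩ => ⟨a, ha, h.symm⟩⟩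
  loopless := ⟨fun _ ⟨a, ha, h⟩ => G.loopless a ha <| by
    rcases h with ⟨h₁, h₂⟩ | ⟨h₁, h₂⟩ <;> rw [h₁, h₂]⟩

theorem verts_of_connects {G : LGraph V Γ} {a : V × V × Γ} {u v : V} (ha : a ∈ G.arcs)
    (h : connects a u v) : u ∈ G.verts ∧ v ∈ G.verts := by
  rcases h with ⟨rfl, rfl⟩ | ⟨rfl, rfl⟩
  · exact ⟨G.tail_mem a ha, G.head_mem a ha⟩
  · exact ⟨G.head_mem a ha, G.tail_mem a ha⟩

theorem mem_verts_of_mem_nbhd {G : LGraph V Γ} {X : Set V} {u : V} (hu : u ∈ G.nbhd X) :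
    u ∈ G.verts := by
  obtain ⟨-, w, -, a, ha, hc⟩ := hu
  exact (verts_of_connects ha hc).2

theorem around_adj_iff {G : LGraph V Γ} {X : Set V} {u w : V} :
    (G.around X).toSimple.Adj u w ↔ G.toSimple.Adj u w ∧ u ∈ X ∪ G.nbhd X ∧
      w ∈ X ∪ G.nbhd X ∧ ¬ (u ∈ G.nbhd X ∧ w ∈ G.nbhd X) := by
  constructor
  · rintro ⟨a, ⟨ha, h₁, h₂, h₃⟩, ⟨rfl, rfl⟩ | ⟨rfl, rfl⟩⟩
    · exact ⟨⟨a, ha, .inl ⟨rfl, rfl⟩⟩, h₁, h₂, h₃⟩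
    · exact ⟨⟨a, ha, .inr ⟨rfl, rfl⟩⟩, h₂, h₁, fun h => h₃ h.symm⟩
  · rintro ⟨⟨a, ha, ⟨rfl, rfl⟩ | ⟨rfl, rfl⟩⟩, h₁, h₂, h₃⟩
    · exact ⟨a, ⟨ha, h₁, h₂, h₃⟩, .inl ⟨rfl, rfl⟩⟩
    · exact ⟨a, ⟨ha, h₂, h₁, fun h => h₃ h.symm⟩, .inr ⟨rfl, rfl⟩⟩

theorem induce_adj_iff {G : LGraph V Γ} {X : Set V} {u w : V} :
    (G.induce X).toSimple.Adj u w ↔ G.toSimple.Adj u w ∧ u ∈ X ∧ w ∈ X := by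
  constructor
  · rintro ⟨a, ⟨ha, h₁, h₂⟩, ⟨rfl, rfl⟩ | ⟨rfl, rfl⟩⟩
    · exact ⟨⟨a, ha, .inl ⟨rfl, rfl⟩⟩, h₁, h₂⟩
    · exact ⟨⟨a, ha, .inr ⟨rfl, rfl⟩⟩, h₂, h₁⟩
  · rintro ⟨⟨a, ha, ⟨rfl, rfl⟩ | ⟨rfl, rfl⟩⟩, h₁, h₂⟩
    · exact ⟨a, ⟨ha, h₁, h₂⟩, .inl ⟨rfl, rfl⟩⟩
    · exact ⟨a, ⟨ha, h₂, h₁⟩, .inr ⟨rfl, rfl⟩⟩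

theorem around_adj_of_mem {G : LGraph V Γ} {X : Set V} {u w : V} (hu : u ∈ X)
    (h : G.toSimple.Adj u w) : (G.around X).toSimple.Adj u w := by
  refine around_adj_iff.mpr ⟨h, .inl hu, ?_, fun h' => h'.1.1 hu⟩
  by_cases hw : w ∈ X
  · exact .inl hw
  · exact .inr ⟨hw, u, hu, h⟩

theorem NoEquivArcs.of_subset {G H : LGraph V Γ} (hG : G.NoEquivArcs) (h : H.arcs ⊆ G.arcs) :
    H.NoEquivArcs :=
  fun a ha b hb => hG a (h ha) b (h hb)

theorem exists_simpleWalk {G : LGraph V Γ} {u v : V} (W : G.Walk u v) :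
    ∃ P : G.toSimple.Walk u v, P.support = W.support := by
  induction W with
  | nil v => exact ⟨.nil, rfl⟩
  | cons u v a ha h W ih =>
    obtain ⟨P, hP⟩ := ih
    exact ⟨.cons ⟨a, ha, h⟩ P, congrArg (u :: ·) hP⟩

theorem exists_walk_of_simpleWalk {G : LGraph V Γ} {u v : V} (P : G.toSimple.Walk u v) :
    ∃ W : G.Walk u v, W.support = P.support := by
  induction P with
  | nil => exact ⟨.nil _, rfl⟩
  | cons h P ih =>
    obtain ⟨W, hW⟩ := ih
    obtain ⟨a, ha, hc⟩ := h
    exact ⟨.cons _ _ a ha hc W, congrArg (_ :: ·) hW⟩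

theorem connected_of_reachable_from {G : LGraph V Γ} (v : V)
    (h : ∀ u ∈ G.verts, G.toSimple.Reachable v u) : G.Connected := by
  intro u hu w hw
  obtain ⟨P⟩ := (h u hu).symm.trans (h w hw)
  exact ⟨(exists_walk_of_simpleWalk P).choose⟩

/-- In a member of `𝒟`, a nonempty vertex set avoiding the terminals has at least two
neighbors. -/
theorem MemD.exists_two_nbhd {G : LGraph V Γ} {s t v : V} {C : Set V} (hD : G.MemD s t)
    (hv : v ∈ G.verts) (hvC : v ∈ C) (hs : s ∉ C) (ht : t ∉ C) :
    ∃ p ∈ G.nbhd C, ∃ q ∈ G.nbhd C, p ≠ q := by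
  obtain ⟨P, hP, hvP⟩ := hD.2.2.2.1 v hv
  obtain ⟨P', hP'⟩ := exists_simpleWalk P
  rw [Walk.IsPath, ← hP'] at hP
  rw [← hP'] at hvP
  obtain ⟨P₁, P₂, rfl⟩ := SimpleGraph.Walk.mem_support_iff_exists_append.mp hvP
  have hpath := (SimpleGraph.Walk.isPath_append_iff P₁ P₂).mp
    ((SimpleGraph.Walk.isPath_def _).mpr hP)
  have hleave : ∀ {e : V} (R : G.toSimple.Walk v e), e ∉ C → ∃ p ∈ R.support, p ∈ G.nbhd C := by
    intro e R he
    obtain ⟨d, hd, h₁, h₂⟩ := R.exists_boundary_dart C hvC he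
    exact ⟨d.snd, R.dart_snd_mem_support_of_mem_darts hd, h₂, d.fst, h₁, d.adj⟩
  obtain ⟨p, hp, hpC⟩ := hleave P₁.reverse hs
  obtain ⟨q, hq, hqC⟩ := hleave P₂ ht
  refine ⟨p, hpC, q, hqC, fun hpq => ?_⟩
  have : p = v := hpath.2.2 p (by simpa using hp) (hpq ▸ hq)
  exact hpC.1 (this ▸ hvC)

theorem around_delete_memD {G : LGraph V Γ} {s t : V} {X : Set V} {x y z : V}
    (hD : G.MemD s t) (h2 : ∀ Y : Set V, ¬ G.TwoContractible s t Y)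
    (hX : X ⊆ G.verts \ {s, t}) (hxy : x ≠ y) (hxz : x ≠ z) (hyz : y ≠ z)
    (hN : G.nbhd X = {x, y, z}) (hconn : (G.induce X).Connected) :
    ((G.around X).delete {x}).MemD y z := by
  have hxN : x ∈ G.nbhd X := by simp [hN]
  have hyN : y ∈ G.nbhd X := by simp [hN]
  have hzN : z ∈ G.nbhd X := by simp [hN]
  set K := (G.around X).delete {x}
  have hmemK : ∀ {u : V}, u ∈ K.verts ↔ u ∈ X ∨ u = y ∨ u = z := by
    intro u
    change (u ∈ G.verts ∧ u ∈ X ∪ G.nbhd X) ∧ u ≠ x ↔ _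
    constructor
    · rintro ⟨⟨-, hu | hu⟩, hux⟩
      · exact .inl hu
      · rw [hN] at hu
        exact .inr (hu.resolve_left hux)
    · rintro (hu | rfl | rfl)
      · exact ⟨⟨(hX hu).1, .inl hu⟩, fun h => hxN.1 (h ▸ hu)⟩
      · exact ⟨⟨mem_verts_of_mem_nbhd hyN, .inr hyN⟩, hxy.symm⟩
      · exact ⟨⟨mem_verts_of_mem_nbhd hzN, .inr hzN⟩, hxz.symm⟩
  have hadjK : ∀ {u w : V}, u ∈ X → w ≠ x → G.toSimple.Adj u w → K.toSimple.Adj u w :=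
    fun hu hw h => induce_adj_iff.mpr
      ⟨around_adj_of_mem hu h, fun h' => hxN.1 (h' ▸ hu), hw⟩
  have hKG : ∀ {u w : V}, K.toSimple.Adj u w → G.toSimple.Adj u w :=
    fun h => (around_adj_iff.mp (induce_adj_iff.mp h).1).1
  have hne : ∀ {u : V}, u ∈ X → u ≠ x := fun hu h => hxN.1 (h ▸ hu)
  have hreach : K.toSimple.Reachable y z := by
    obtain ⟨-, y', hy', hyy'⟩ := hyN
    obtain ⟨-, z', hz', hzz'⟩ := hzN
    obtain ⟨W⟩ := hconn y' ⟨(hX hy').1, hy'⟩ z' ⟨(hX hz').1, hz'⟩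
    obtain ⟨W', -⟩ := exists_simpleWalk W
    have hW : K.toSimple.Reachable y' z' := W'.reachable_of_adj_imp fun a _ b _ hab =>
      hadjK (induce_adj_iff.mp hab).2.1 (hne (induce_adj_iff.mp hab).2.2)
        (induce_adj_iff.mp hab).1
    exact (hadjK hy' hxy.symm hyy').reachable.symm.trans
      (hW.trans (hadjK hz' hxz.symm hzz').reachable)
  obtain ⟨P, hP⟩ := hreach.exists_isPath
  have hyT : y ∈ K.toSimple.onPath y z := ⟨P, hP, P.start_mem_support⟩
  have hzT : z ∈ K.toSimple.onPath y z := ⟨P, hP, P.end_mem_support⟩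
  refine ⟨hyz, hmemK.mpr (by simp), hmemK.mpr (by simp), fun v hv => ?_,
    hD.2.2.2.2.of_subset fun a ha => ha.1.1⟩
  suffices hvT : v ∈ K.toSimple.onPath y z by
    obtain ⟨Q, hQ, hvQ⟩ := hvT
    obtain ⟨W, hW⟩ := exists_walk_of_simpleWalk Q
    exact ⟨W, by rw [Walk.IsPath, hW]; exact hQ.support_nodup, hW ▸ hvQ⟩
  by_contra hvT
  set C := K.toSimple.reachAvoiding (K.toSimple.onPath y z) v
  have hvX : v ∈ X := by
    rcases hmemK.mp hv with h | rfl | rfl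
    · exact h
    · exact (hvT hyT).elim
    · exact (hvT hzT).elim
  have hvC : v ∈ C := ⟨.nil, by simpa using hvT⟩
  have hCX : C ⊆ X := by
    intro u hu
    have huT := SimpleGraph.notMem_of_mem_reachAvoiding hu
    obtain ⟨W, -⟩ := hu
    have huK : u ∈ K.verts := by
      cases hW : W.reverse with
      | nil => exact hv
      | cons h _ =>
        obtain ⟨a, ha, hc⟩ := h
        exact (verts_of_connects ha hc).1
    rcases hmemK.mp huK with h | rfl | rfl
    · exact h
    · exact (huT hyT).elim
    · exact (huT hzT).elim
  have hnbhdT : ∀ u ∈ G.nbhd C, u ≠ x →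
      u ∈ K.toSimple.onPath y z ∧ ∃ c ∈ C, K.toSimple.Adj c u := by
    rintro u ⟨huC, c, hc, hcu⟩ hux
    have hadj := hadjK (hCX hc) hux hcu
    exact ⟨by_contra fun h => huC (SimpleGraph.mem_reachAvoiding_of_adj hc hadj h), c, hc, hadj⟩
  have hunique : ∀ u ∈ G.nbhd C, ∀ w ∈ G.nbhd C, u ≠ x → w ≠ x → u = w := by
    intro u hu w hw hux hwx
    obtain ⟨huT, c, hc, hcu⟩ := hnbhdT u hu hux
    obtain ⟨hwT, d, hd, hdw⟩ := hnbhdT w hw hwx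
    exact SimpleGraph.eq_of_adj_reachAvoiding_onPath huT hwT hc hd hcu.symm hdw
  obtain ⟨p, hp, q, hq, hpq⟩ := hD.exists_two_nbhd (hX hvX).1 hvC
    (fun h => (hX (hCX h)).2 (by simp)) (fun h => (hX (hCX h)).2 (by simp))
  have hxb : ∃ b, b ≠ x ∧ G.nbhd C = {x, b} := by
    have hx : x ∈ G.nbhd C := by
      by_contra hx
      exact hpq (hunique p hp q hq (fun h => hx (h ▸ hp)) (fun h => hx (h ▸ hq)))
    obtain ⟨b, hb, hbx⟩ : ∃ b ∈ G.nbhd C, b ≠ x := by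
      by_cases h : p = x
      · exact ⟨q, hq, fun h' => hpq (h.trans h'.symm)⟩
      · exact ⟨p, hp, h⟩
    refine ⟨b, hbx, Set.Subset.antisymm (fun u hu => ?_) ?_⟩
    · by_cases hux : u = x
      · exact .inl hux
      · exact .inr (hunique u hu b hb hux hbx)
    · rintro u (rfl | rfl)
      · exact hx
      · exact hb
  obtain ⟨b, hbx, hNC⟩ := hxb
  refine h2 C ⟨hCX.trans hX, ⟨x, b, hbx.symm, hNC⟩, ?_, ?_⟩
  · have hCreach : ∀ u ∈ C, (G.around C).toSimple.Reachable v u := by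
      rintro u ⟨W, hW⟩
      exact W.reachable_of_adj_imp fun a ha c _ hac =>
        around_adj_of_mem (SimpleGraph.mem_reachAvoiding_of_mem_support hW ha) (hKG hac)
    refine connected_of_reachable_from v fun u hu => ?_
    rcases hu.2 with hu | ⟨-, c, hc, hcu⟩
    · exact hCreach u hu
    · exact (hCreach c hc).trans (around_adj_of_mem hc hcu).reachable
  · intro hG
    have hall : ∀ u ∈ G.verts, u ∉ C → u ≠ x → u = b := by
      intro u hu huC hux
      rw [← hG] at hu
      have := hu.2.resolve_left huC
      rw [hNC] at this
      exact this.resolve_left hux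
    have hy := hall y (mem_verts_of_mem_nbhd hyN) (fun h => hyN.1 (hCX h)) hxy.symm
    have hz := hall z (mem_verts_of_mem_nbhd hzN) (fun h => hzN.1 (hCX h)) hxz.symm
    exact hyz (hy.trans hz.symm)

end LGraph

open LGraph in
/-- Let `(G, s, t) ∈ 𝒟` contain no 2-contractible and no
3-contractible vertex set, and let `X ⊆ V(G)∖{s,t}` satisfy `N_G(X) = {x, y, z}`
(distinct) with `G[X]` connected.  Then `(G⟦X⟧ − x, y, z) ∈ 𝒟`,
`(G⟦X⟧ − y, z, x) ∈ 𝒟`, and `(G⟦X⟧ − z, x, y) ∈ 𝒟`. -/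
theorem threeCut_memD {V Γ : Type} [Group Γ] [DecidableEq V]
    (G : LGraph V Γ) (s t : V) (X : Set V) (x y z : V)
    (hD : G.MemD s t)
    (h2 : ∀ Y : Set V, ¬ G.TwoContractible s t Y)
    (h3 : ∀ Y : Set V, ¬ G.ThreeContractible s t Y)
    (hX : X ⊆ G.verts \ {s, t})
    (hxy : x ≠ y) (hxz : x ≠ z) (hyz : y ≠ z)
    (hN : G.nbhd X = {x, y, z})
    (hconn : (G.induce X).Connected) :
    ((G.around X).delete {x}).MemD y z ∧
    ((G.around X).delete {y}).MemD z x ∧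
    ((G.around X).delete {z}).MemD x y := by
  exact ⟨around_delete_memD hD h2 hX hxy hxz hyz hN hconn,
    around_delete_memD hD h2 hX hyz hxy.symm hxz.symm
      (by rw [hN]; ext u; simp; tauto) hconn,
    around_delete_memD hD h2 hX hxz.symm hyz.symm hxy
      (by rw [hN]; ext u; simp; tauto) hconn⟩
end

section
/- Let Γ be a group and let (𝔾, s, t) ∈ 𝒟 be such that 𝔾 contains no 2-contractible vertex set and no 3-contractible vertex set. Let X ⊆ V(𝔾)∖{s,t} be a vertex set with N_𝔾(X) = {x, y, z} for distinct vertices x, y, z such that the induced subgraph 𝔾[X] is connected. Then at least two of the following three inequalities hold: |l(𝔾⟦X⟧ − x; y, z)| ≥ 2, |l(𝔾⟦X⟧ − y; z, x)| ≥ 2, and |l(𝔾⟦X⟧ − z; x, y)| ≥ 2. -/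
theorem List.pair_sublist_or {V : Type} {L : List V} {u v : V} (hu : u ∈ L) (hv : v ∈ L) (h : u ≠ v) :
    [u, v].Sublist L ∨ [v, u].Sublist L := by
  obtain ⟨A, B, rfl⟩ := List.append_of_mem hu
  rcases List.mem_append.1 hv with hv | hv
  · exact .inr (List.Sublist.append (List.singleton_sublist.2 hv) (by simp) : ([v] ++ [u]).Sublist _)
  · have : v ∈ B := by grind
    exact .inl ((List.Sublist.cons_cons u (by simpa)).trans (List.sublist_append_right _ _))

theorem List.idxOf_lt_of_pair_sublist {V : Type} [DecidableEq V] {L : List V} {a b : V} (hL : L.Nodup)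
    (h : [a, b].Sublist L) : L.idxOf a < L.idxOf b := by
  induction L with
  | nil => simp at h
  | cons c L ih => grind

/-- `L` lists distinct vertices from `y` to `z` so that every other listed vertex has a neighbour
before it and a neighbour after it. -/
structure SimpleGraph.IsBipolarList {V : Type} (S : SimpleGraph V) (y z : V) (L : List V) :
    Prop where
  nodup : L.Nodup
  head : L.head? = some y
  last : L.getLast? = some z
  between : ∀ w ∈ L, w ≠ y → w ≠ z →
    (∃ a, S.Adj a w ∧ [a, w].Sublist L) ∧ ∃ b, S.Adj w b ∧ [w, b].Sublist L

namespace SimpleGraph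

variable {V : Type} {S : SimpleGraph V} {y z : V}

theorem IsBipolarList.insert_ear {L P : List V} {u v : V} (hL : S.IsBipolarList y z L)
    (huv : [u, v].Sublist L) (hP : P.Nodup) (hPL : ∀ p ∈ P, p ∉ L)
    (hc : (u :: (P ++ [v])).IsChain S.Adj) :
    ∃ L', S.IsBipolarList y z L' ∧ ∀ w, w ∈ L' ↔ w ∈ L ∨ w ∈ P := by
  obtain ⟨A, B, rfl, hu, hv⟩ := List.cons_sublist_iff.1 huv
  obtain ⟨A, A', rfl⟩ := List.append_of_mem hu
  rw [List.singleton_sublist] at hv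
  have hsub : (A ++ u :: A' ++ B).Sublist (A ++ u :: (P ++ (A' ++ B))) := by
    simp
  refine ⟨A ++ u :: (P ++ (A' ++ B)), ⟨?_, ?_, ?_, ?_⟩, by grind⟩
  · have h : (P ++ (A ++ u :: A' ++ B)).Nodup :=
      List.nodup_append'.2 ⟨hP, hL.nodup, fun p hp hp' => hPL p hp hp'⟩
    refine (List.Perm.nodup_iff ?_).1 h
    have h₁ := (List.perm_append_comm (l₁ := P) (l₂ := A ++ [u])).append_right (A' ++ B)
    simpa using h₁
  · have := hL.head
    cases A <;> simp_all
  · have := hL.last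
    have hB : B ≠ [] := List.ne_nil_of_mem hv
    grind
  · intro w hw hwy hwz
    by_cases hwP : w ∈ P
    · obtain ⟨P₁, P₂, rfl⟩ := List.append_of_mem hwP
      constructor
      · obtain ⟨Q, a, hQ⟩ := List.eq_nil_or_concat' (u :: P₁) |>.resolve_left (by simp)
        have h : u :: (P₁ ++ w :: P₂ ++ [v]) = Q ++ a :: w :: (P₂ ++ [v]) := by
          have : u :: (P₁ ++ w :: P₂ ++ [v]) = (u :: P₁) ++ w :: (P₂ ++ [v]) := by simp
          rw [this, hQ]; simp
        rw [h, List.isChain_append_cons_cons] at hc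
        refine ⟨a, hc.2.1, ?_⟩
        have h' : A ++ u :: (P₁ ++ w :: P₂ ++ (A' ++ B)) = A ++ ((Q ++ [a]) ++ w :: (P₂ ++ (A' ++ B))) := by
          rw [← hQ]; simp
        rw [h', List.append_assoc Q]
        exact .trans (List.Sublist.append (.refl [a]) (by simp : [w].Sublist _))
          ((List.sublist_append_right _ _).trans (List.sublist_append_right _ _))
      · rcases P₂ with _ | ⟨b, P₂⟩
        · have h : u :: (P₁ ++ [w] ++ [v]) = (u :: P₁) ++ w :: v :: [] := by simp
          rw [h, List.isChain_append_cons_cons] at hc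
          refine ⟨v, hc.2.1, ?_⟩
          have : [v].Sublist B := by simpa
          have h' : A ++ u :: (P₁ ++ [w] ++ (A' ++ B)) = (A ++ u :: P₁) ++ ([w] ++ (A' ++ B)) := by simp
          rw [h']
          exact .trans (List.Sublist.append (.refl [w]) (this.trans (List.sublist_append_right _ _)))
            (List.sublist_append_right _ _)
        · have h : u :: (P₁ ++ w :: b :: P₂ ++ [v]) = (u :: P₁) ++ w :: b :: (P₂ ++ [v]) := by simp
          rw [h, List.isChain_append_cons_cons] at hc
          refine ⟨b, hc.2.1, ?_⟩
          have h' : A ++ u :: (P₁ ++ w :: b :: P₂ ++ (A' ++ B)) =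
            (A ++ u :: P₁) ++ ([w, b] ++ (P₂ ++ (A' ++ B))) := by simp
          rw [h']
          exact (List.sublist_append_left _ _).trans (List.sublist_append_right _ _)
    · obtain ⟨⟨a, ha, ha'⟩, b, hb, hb'⟩ := hL.between w (by grind) hwy hwz
      exact ⟨⟨a, ha, ha'.trans hsub⟩, b, hb, hb'.trans hsub⟩

theorem IsBipolarList.exists_larger {W : Set V} {L : List V} (hL : S.IsBipolarList y z L)
    (hsep : ∀ D ⊆ W, D.Nonempty → y ∉ D → z ∉ D → ∀ w,
      ∃ d ∈ D, ∃ v ∈ W, v ∉ D ∧ v ≠ w ∧ S.Adj d v)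
    (hLW : ∀ w ∈ L, w ∈ W) {d : V} (hdW : d ∈ W) (hdL : d ∉ L) :
    ∃ L', S.IsBipolarList y z L' ∧ (∀ w ∈ L', w ∈ W) ∧ L.length < L'.length := by
  have hy : y ∈ L := List.mem_of_mem_head? hL.head
  have hz : z ∈ L := List.mem_of_mem_getLast? hL.last
  let T : SimpleGraph V :=
    { Adj a b := S.Adj a b ∧ (a ∈ W ∧ a ∉ L) ∧ (b ∈ W ∧ b ∉ L)
      symm := ⟨fun a b h => ⟨h.1.symm, h.2.2, h.2.1⟩⟩
      loopless := ⟨fun a h => h.1.ne rfl⟩ }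
  have hT {a b : V} (p : T.Walk a b) (ha : a ∈ W ∧ a ∉ L) : ∀ c ∈ p.support, c ∈ W ∧ c ∉ L := by
    induction p with
    | nil => simpa using ha
    | cons h p ih => simpa using ⟨ha, ih h.2.2⟩
  let D : Set V := {a | T.Reachable d a}
  have hD : ∀ a ∈ D, a ∈ W ∧ a ∉ L := fun a ⟨p⟩ => hT p ⟨hdW, hdL⟩ a p.end_mem_support
  have hout : ∀ w, ∃ a ∈ D, ∃ v ∈ L, v ≠ w ∧ S.Adj a v := by
    intro w
    obtain ⟨a, ha, v, hv, hvD, hvw, hav⟩ := hsep D (fun a ha => (hD a ha).1) ⟨d, .refl d⟩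
      (fun h => (hD y h).2 hy) (fun h => (hD z h).2 hz) w
    refine ⟨a, ha, v, by_contra fun hvL => hvD ?_, hvw, hav⟩
    exact Reachable.trans ha (Adj.reachable ⟨hav, hD a ha, hv, hvL⟩)
  obtain ⟨a, ha, u, hu, -, hau⟩ := hout y
  obtain ⟨b, hb, v, hv, hvu, hbv⟩ := hout u
  have key : ∀ a b u v, a ∈ D → b ∈ D → S.Adj a u → S.Adj b v → [u, v].Sublist L →
      ∃ L', S.IsBipolarList y z L' ∧ (∀ w ∈ L', w ∈ W) ∧ L.length < L'.length := by
    intro a b u v ha hb hau hbv huv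
    classical
    obtain ⟨p, hp⟩ := (Reachable.trans (Reachable.symm ha) hb).exists_isPath
    have hpL := hT p (hD a ha)
    obtain ⟨L', hL', hmem⟩ := hL.insert_ear huv hp.support_nodup (fun c hc => (hpL c hc).2) (by
      have hc : p.support.IsChain S.Adj := p.isChain_adj_support.imp fun _ _ h => h.1
      rw [List.isChain_cons, List.isChain_append]
      have h1 : p.support.head? = some a := by rw [← p.cons_tail_support]; rfl
      have h2 : p.support.getLast? = some b := by
        rw [List.getLast?_eq_some_getLast (by simp), p.getLast_support]
      refine ⟨?_, hc, by simp, ?_⟩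
      · intro c hc
        have : c = a := by grind
        exact this ▸ hau.symm
      · intro c hc e he
        have : c = b := by grind
        have : e = v := by grind
        subst c e
        exact hbv)
    refine ⟨L', hL', fun w hw => ((hmem w).1 hw).elim (hLW w) fun h => (hpL w h).1, ?_⟩
    rw [← List.toFinset_card_of_nodup hL.nodup, ← List.toFinset_card_of_nodup hL'.nodup]
    refine Finset.card_lt_card (Finset.ssubset_iff_of_subset ?_ |>.2 ⟨a, ?_, ?_⟩)
    · intro w; simp only [List.mem_toFinset, hmem]; exact .inl
    · simp [hmem]
    · simpa using (hD a ha).2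
  rcases List.pair_sublist_or hu hv hvu.symm with h | h
  · exact key a b u v ha hb hau hbv h
  · exact key b a v u hb ha hbv hau h

theorem exists_isBipolarList {W : Set V} (hW : W.Finite) (hyz : y ≠ z) (hy : y ∈ W) (hz : z ∈ W)
    (hsep : ∀ D ⊆ W, D.Nonempty → y ∉ D → z ∉ D → ∀ w,
      ∃ d ∈ D, ∃ v ∈ W, v ∉ D ∧ v ≠ w ∧ S.Adj d v) :
    ∃ L, S.IsBipolarList y z L ∧ ∀ w, w ∈ L ↔ w ∈ W := by
  classical
  by_contra! hno
  have grow : ∀ n : ℕ, ∃ L, S.IsBipolarList y z L ∧ (∀ w ∈ L, w ∈ W) ∧ n ≤ L.length := by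
    intro n
    induction n with
    | zero => exact ⟨[y, z], ⟨by simpa, rfl, rfl, by grind⟩, by grind, by simp⟩
    | succ n ih =>
      obtain ⟨L, hL, hLW, hn⟩ := ih
      obtain ⟨d, hd⟩ := hno L hL
      obtain ⟨L', hL', hLW', hlt⟩ := hL.exists_larger hsep hLW (d := d) (by grind) (by grind)
      exact ⟨L', hL', hLW', by omega⟩
  obtain ⟨L, hL, hLW, hn⟩ := grow (hW.toFinset.card + 1)
  have : L.toFinset.card ≤ hW.toFinset.card :=
    Finset.card_le_card fun w hw => by simpa using hLW w (by simpa using hw)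
  rw [List.toFinset_card_of_nodup hL.nodup] at this
  omega

/-- A numbering in which every vertex of `W` other than the least `y` and the greatest `z` has both
a lower and a higher neighbour. -/
theorem exists_bipolar_numbering {W : Set V} (hW : W.Finite) (hyz : y ≠ z) (hy : y ∈ W)
    (hz : z ∈ W)
    (hsep : ∀ D ⊆ W, D.Nonempty → y ∉ D → z ∉ D → ∀ w,
      ∃ d ∈ D, ∃ v ∈ W, v ∉ D ∧ v ≠ w ∧ S.Adj d v) :
    ∃ f : V → ℕ, Set.InjOn f W ∧ (∀ w ∈ W, w ≠ y → w ≠ z →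
      (∃ a ∈ W, S.Adj a w ∧ f a < f w) ∧ ∃ b ∈ W, S.Adj w b ∧ f w < f b) ∧
      (∀ w ∈ W, f y ≤ f w) ∧ ∀ w ∈ W, f w ≤ f z := by
  classical
  obtain ⟨L, hL, hLW⟩ := exists_isBipolarList hW hyz hy hz hsep
  refine ⟨L.idxOf, fun a ha b _ h => (List.idxOf_inj ((hLW a).2 ha)).1 h, fun w hw hwy hwz => ?_,
    fun w hw => ?_, fun w hw => ?_⟩
  · obtain ⟨⟨a, ha, ha'⟩, b, hb, hb'⟩ := hL.between w ((hLW w).2 hw) hwy hwz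
    exact ⟨⟨a, (hLW a).1 (ha'.subset (by simp)), ha, List.idxOf_lt_of_pair_sublist hL.nodup ha'⟩,
      b, (hLW b).1 (hb'.subset (by simp)), hb, List.idxOf_lt_of_pair_sublist hL.nodup hb'⟩
  · have := hL.head
    cases L <;> simp_all
  · obtain ⟨M, rfl⟩ := List.getLast?_eq_some_iff.1 hL.last
    have h := hL.nodup
    have := (hLW w).2 hw
    by_cases hwz : w = z
    · rw [hwz]
    · have hzM : z ∉ M := by grind
      have hwM : w ∈ M := by grind
      exact (List.idxOf_lt_of_pair_sublist h (List.Sublist.append (l₁ := [w]) (by simpa) (.refl [z]))).le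

end SimpleGraph

namespace LGraph

theorem connects.symm {V Γ : Type} {a : V × V × Γ} {u v : V} (h : connects a u v) : connects a v u :=
  Or.symm h

variable {V Γ : Type} [Group Γ]

/-- The simple graph underlying a labeled graph. -/
def toSimpleGraph (G : LGraph V Γ) : SimpleGraph V where
  Adj u v := ∃ a ∈ G.arcs, connects a u v
  symm := ⟨fun _ _ ⟨a, ha, h⟩ => ⟨a, ha, h.symm⟩⟩
  loopless := ⟨fun _ ⟨a, ha, h⟩ => G.loopless a ha <| by
    rcases h with ⟨h, h'⟩ | ⟨h, h'⟩ <;> rw [h, h']⟩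

/-- `u` and `v` are joined by a walk. -/
def Joined (G : LGraph V Γ) (u v : V) : Prop := Nonempty (G.Walk u v)

theorem Joined.refl {G : LGraph V Γ} (u : V) : G.Joined u u := ⟨.nil u⟩

theorem Joined.trans {G : LGraph V Γ} {u v w : V} (h : G.Joined u v) (h' : G.Joined v w) :
    G.Joined u w := by
  obtain ⟨p⟩ := h
  induction p with
  | nil => exact h'
  | cons u v a ha hs _ ih =>
    obtain ⟨q⟩ := ih h'
    exact ⟨.cons u v a ha hs q⟩

theorem Joined.of_connects {G : LGraph V Γ} {u v : V} {a : V × V × Γ} (ha : a ∈ G.arcs)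
    (h : connects a u v) : G.Joined u v := ⟨.cons u v a ha h (.nil v)⟩

theorem Joined.symm {G : LGraph V Γ} {u v : V} (h : G.Joined u v) : G.Joined v u := by
  obtain ⟨p⟩ := h
  induction p with
  | nil => exact .refl _
  | cons u v a ha hs _ ih => exact ih.trans (.of_connects ha hs.symm)

theorem Joined.mono {G H : LGraph V Γ} (hGH : G.arcs ⊆ H.arcs) {u v : V} (h : G.Joined u v) :
    H.Joined u v := by
  obtain ⟨p⟩ := h
  induction p with
  | nil => exact .refl _
  | cons u v a ha hs _ ih => exact (Joined.of_connects (hGH ha) hs).trans ih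

/-- A potential certifies the label of every arc as a difference of vertex values. -/
def IsPotential (G : LGraph V Γ) (φ : V → Γ) : Prop :=
  ∀ a ∈ G.arcs, φ a.2.1 = a.2.2 * φ a.1

/-- Two potentials differ by a constant along every walk. -/
theorem IsPotential.inv_mul_eq {G : LGraph V Γ} {φ ψ : V → Γ} (hφ : G.IsPotential φ)
    (hψ : G.IsPotential ψ) {u v : V} (h : G.Joined u v) :
    (ψ u)⁻¹ * φ u = (ψ v)⁻¹ * φ v := by
  obtain ⟨p⟩ := h
  induction p with
  | nil => rfl
  | cons u v a ha hs _ ih =>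
    rw [← ih]
    rcases hs with ⟨rfl, rfl⟩ | ⟨rfl, rfl⟩ <;> rw [hφ a ha, hψ a ha] <;> group

/-- A walk leaving a set of vertices passes through its neighbourhood. -/
theorem Walk.mem_support_of_leaves {G : LGraph V Γ} {D : Set V} {c : V} (hD : G.nbhd D ⊆ {c})
    {u v : V} (p : G.Walk u v) (hu : u ∈ D) (hv : v ∉ D) : c ∈ p.support := by
  induction p with
  | nil => exact (hv hu).elim
  | cons u w a ha hs p ih =>
    refine List.mem_cons_of_mem _ ?_
    by_cases hw : w ∈ D
    · exact ih hw hv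
    · obtain rfl : w = c := hD ⟨hw, u, hu, a, ha, hs⟩
      cases p <;> simp [support]

/-- A path with both ends outside a vertex set with at most one neighbour avoids that set. -/
theorem Walk.IsPath.notMem_of_nbhd_subset {G : LGraph V Γ} {D : Set V} {c : V}
    (hD : G.nbhd D ⊆ {c}) {u v : V} {p : G.Walk u v} (hp : p.IsPath) (hu : u ∉ D) (hv : v ∉ D) :
    ∀ d ∈ p.support, d ∉ D := by
  induction p with
  | nil => simpa [support]
  | cons u w a ha hs p ih =>
    obtain ⟨hup, hp⟩ := List.nodup_cons.1 hp
    by_cases hw : w ∈ D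
    · obtain rfl : u = c := hD ⟨hu, w, hw, a, ha, hs.symm⟩
      exact (hup (p.mem_support_of_leaves hD hw hv)).elim
    · intro d hd
      rcases List.mem_cons.1 hd with rfl | hd
      · exact hu
      · exact ih hp hw hv d hd

theorem induce_joined_mem {G : LGraph V Γ} {D : Set V} {u v : V} (h : (G.induce D).Joined u v)
    (hu : u ∈ D) : v ∈ D := by
  obtain ⟨p⟩ := h
  induction p with
  | nil => exact hu
  | cons u v a ha hs _ ih =>
    rcases hs with ⟨-, rfl⟩ | ⟨rfl, -⟩
    · exact ih ha.2.2
    · exact ih ha.2.1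

theorem mem_verts_of_connects {G : LGraph V Γ} {a : V × V × Γ} (ha : a ∈ G.arcs) {u v : V}
    (h : connects a u v) : u ∈ G.verts := by
  rcases h with ⟨rfl, -⟩ | ⟨-, rfl⟩
  · exact G.tail_mem a ha
  · exact G.head_mem a ha

theorem mem_around_arcs {G : LGraph V Γ} {X : Set V} {a : V × V × Γ} (ha : a ∈ G.arcs) {u v : V}
    (h : connects a u v) (hu : u ∈ X) : a ∈ (G.around X).arcs := by
  have hv : v ∈ X ∪ G.nbhd X := by
    by_cases hv : v ∈ X
    · exact .inl hv
    · exact .inr ⟨hv, u, hu, a, ha, h⟩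
  have hu' : u ∉ G.nbhd X := fun h => h.1 hu
  rcases h with ⟨rfl, rfl⟩ | ⟨rfl, rfl⟩
  · exact ⟨ha, .inl hu, hv, fun h => hu' h.1⟩
  · exact ⟨ha, hv, .inl hu, fun h => hu' h.2⟩

theorem around_connected {G : LGraph V Γ} {D : Set V} {d : V}
    (hD : ∀ u ∈ D, (G.around D).Joined d u) : (G.around D).Connected := by
  suffices ∀ u ∈ (G.around D).verts, (G.around D).Joined d u from
    fun u hu v hv => (this u hu).symm.trans (this v hv)
  rintro u ⟨-, hu | ⟨-, v, hv, a, ha, hc⟩⟩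
  · exact hD u hu
  · exact (hD v hv).trans (.of_connects (mem_around_arcs ha hc hv) hc)

/-- Without 2-contractible sets, a nonempty set of nonterminal vertices that misses two vertices
`y`, `z` other than `x` has a neighbour other than `x` and any prescribed vertex. -/
theorem exists_nbhd_of_not_twoContractible {G : LGraph V Γ} {s t : V} (hD : G.MemD s t)
    (h2 : ∀ Y : Set V, ¬ G.TwoContractible s t Y) {D : Set V} (hDv : D ⊆ G.verts \ {s, t})
    (hne : D.Nonempty) {x y z : V} (hyz : y ≠ z) (hxy : x ≠ y) (hxz : x ≠ z) (hy : y ∈ G.verts)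
    (hz : z ∈ G.verts) (hyD : y ∉ D) (hzD : z ∉ D) (w : V) :
    ∃ v ∈ G.nbhd D, v ≠ x ∧ v ≠ w := by
  by_contra! hcon
  obtain ⟨d, hd⟩ := hne
  let E : Set V := {u | (G.induce D).Joined d u}
  have hED : E ⊆ D := fun u hu => induce_joined_mem hu hd
  have hdE : d ∈ E := Joined.refl d
  have hadj : ∀ u ∈ E, ∀ v ∈ D, ∀ a ∈ G.arcs, connects a u v → v ∈ E := by
    intro u hu v hv a ha hc
    refine Joined.trans hu (.of_connects ⟨ha, ?_⟩ hc)
    rcases hc with ⟨rfl, rfl⟩ | ⟨rfl, rfl⟩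
    · exact ⟨hED hu, hv⟩
    · exact ⟨hv, hED hu⟩
  have hNE : G.nbhd E ⊆ {x, w} := by
    rintro v ⟨hvE, u, hu, a, ha, hc⟩
    have hvD : v ∉ D := fun h => hvE (hadj u hu v h a ha hc)
    by_cases hvx : v = x
    · exact .inl hvx
    · exact .inr (hcon v ⟨hvD, u, hED hu, a, ha, hc⟩ hvx)
  have hsmall : ∀ c, ¬ G.nbhd E ⊆ {c} := by
    intro c hc
    obtain ⟨P, hP, hdP⟩ := hD.2.2.2.1 d (hDv hd).1
    exact hP.notMem_of_nbhd_subset hc (fun h => (hDv (hED h)).2 (.inl rfl))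
      (fun h => (hDv (hED h)).2 (.inr rfl)) d hdP hdE
  have hxE : x ∈ G.nbhd E := by_contra fun h => hsmall w fun v hv =>
    (hNE hv).resolve_left fun e => h (e ▸ hv)
  have hwE : w ∈ G.nbhd E := by_contra fun h => hsmall x fun v hv =>
    (hNE hv).resolve_right fun e => h ((show v = w from e) ▸ hv)
  have hxw : x ≠ w := by
    rintro rfl
    exact hsmall x (by simpa using hNE)
  refine h2 E ⟨hED.trans hDv, ⟨x, w, hxw, hNE.antisymm ?_⟩, around_connected (d := d) ?_, ?_⟩
  · rintro v (rfl | rfl)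
    exacts [hxE, hwE]
  · rintro u ⟨p⟩
    have key : ∀ {b c : V}, (G.induce D).Walk b c → b ∈ E → (G.around E).Joined b c := by
      intro b c p hb
      induction p with
      | nil => exact .refl _
      | cons b v a ha hs _ ih =>
        exact (Joined.of_connects (mem_around_arcs ha.1 hs hb) hs).trans
          (ih (Joined.trans hb (.of_connects ha hs)))
    exact key p hdE
  · intro heq
    have hmem : ∀ v ∈ G.verts, v ∉ D → v ∈ G.nbhd E := by
      intro v hv hvD
      rw [← heq] at hv
      exact hv.2.resolve_left fun h => hvD (hED h)
    have hyw := (hNE (hmem y hy hyD)).resolve_left hxy.symm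
    have hzw := (hNE (hmem z hz hzD)).resolve_left hxz.symm
    exact hyz (hyw.trans hzw.symm)

variable [DecidableEq V]

theorem IsPotential.stepLabel_eq {G : LGraph V Γ} {φ : V → Γ} (hφ : G.IsPotential φ)
    {a : V × V × Γ} (ha : a ∈ G.arcs) {u v : V} (h : connects a u v) :
    φ v = stepLabel v a * φ u := by
  rcases h with ⟨rfl, rfl⟩ | ⟨rfl, rfl⟩
  · simp [stepLabel, hφ a ha]
  · simp [stepLabel, hφ a ha, (G.loopless a ha).symm]

theorem IsPotential.label_eq {G : LGraph V Γ} {φ : V → Γ} (hφ : G.IsPotential φ) {u v : V}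
    (p : G.Walk u v) : φ v = p.label * φ u := by
  induction p with
  | nil => simp [Walk.label]
  | cons u v a ha hs _ ih => rw [ih, hφ.stepLabel_eq ha hs, Walk.label, mul_assoc]

theorem IsPotential.balanced {G : LGraph V Γ} {φ : V → Γ} (hφ : G.IsPotential φ) :
    G.Balanced := fun _ p _ => mul_eq_right.1 (hφ.label_eq p).symm

/-- `γ` is the label of a walk from `u` to `v` along which `f` strictly increases. -/
inductive Ascends (G : LGraph V Γ) (f : V → ℕ) : V → V → Γ → Prop
  | refl (u : V) : Ascends G f u u 1
  | step {u v w : V} {γ : Γ} {a : V × V × Γ} (ha : a ∈ G.arcs) (hs : connects a u v)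
      (hlt : f u < f v) (h : Ascends G f v w γ) : Ascends G f u w (γ * stepLabel v a)

theorem Ascends.trans {G : LGraph V Γ} {f : V → ℕ} {u v w : V} {γ δ : Γ}
    (h : G.Ascends f u v γ) (h' : G.Ascends f v w δ) : G.Ascends f u w (δ * γ) := by
  induction h with
  | refl => simpa using h'
  | step ha hs hlt _ ih => rw [← mul_assoc]; exact .step ha hs hlt (ih h')

theorem Ascends.of_connects {G : LGraph V Γ} {f : V → ℕ} {u v : V} {a : V × V × Γ}
    (ha : a ∈ G.arcs) (hs : connects a u v) (hlt : f u < f v) :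
    G.Ascends f u v (stepLabel v a) := by
  simpa using Ascends.step ha hs hlt (.refl v)

theorem Ascends.mem_labelSet {G : LGraph V Γ} {f : V → ℕ} {u v : V} {γ : Γ}
    (h : G.Ascends f u v γ) : γ ∈ G.labelSet u v := by
  suffices ∃ P : G.Walk u v, P.IsPath ∧ P.label = γ ∧ ∀ w ∈ P.support, f u ≤ f w by
    obtain ⟨P, hP, hl, -⟩ := this
    exact ⟨P, hP, hl⟩
  induction h with
  | refl u => exact ⟨.nil u, by simp [Walk.IsPath, Walk.support], rfl, by simp [Walk.support]⟩
  | @step u v w γ a ha hs hlt _ ih =>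
    obtain ⟨P, hP, hl, hf⟩ := ih
    refine ⟨.cons u v a ha hs P, ?_, by rw [Walk.label, hl], ?_⟩
    · exact List.nodup_cons.2 ⟨fun hu => (hf u hu).not_gt hlt, hP⟩
    · intro b hb
      rcases List.mem_cons.1 hb with rfl | hb
      · rfl
      · exact hlt.le.trans (hf b hb)

/-- If no vertex separates a vertex set from `{y, z}` and all `y`–`z` paths have the same label,
then the graph has a potential. -/
theorem exists_isPotential {G : LGraph V Γ} {y z : V} (hyz : y ≠ z) (hy : y ∈ G.verts)
    (hz : z ∈ G.verts)
    (hsep : ∀ D ⊆ G.verts, D.Nonempty → y ∉ D → z ∉ D → ∀ w,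
      ∃ d ∈ D, ∃ v ∈ G.verts, v ∉ D ∧ v ≠ w ∧ G.toSimpleGraph.Adj d v)
    (hl : (G.labelSet y z).Subsingleton) : ∃ φ, G.IsPotential φ := by
  obtain ⟨f, hinj, hbet, hfy, hfz⟩ :=
    SimpleGraph.exists_bipolar_numbering G.verts_finite hyz hy hz hsep
  have hdown : ∀ n, ∀ v ∈ G.verts, f v = n → v ≠ z → ∃ γ, G.Ascends f y v γ := by
    intro n
    induction n using Nat.strong_induction_on with
    | _ n ih =>
      intro v hv hn hvz
      by_cases hvy : v = y
      · exact ⟨1, hvy ▸ .refl v⟩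
      · obtain ⟨a, ha, ⟨e, he, hc⟩, hlt⟩ := (hbet v hv hvy hvz).1
        obtain ⟨γ, hγ⟩ := ih (f a) (hn ▸ hlt) a ha rfl
          (fun h => (hfz v hv).not_gt (h ▸ hlt))
        exact ⟨_, hγ.trans (.of_connects he hc hlt)⟩
  have hup : ∀ n, ∀ v ∈ G.verts, f z - f v = n → v ≠ y → ∃ γ, G.Ascends f v z γ := by
    intro n
    induction n using Nat.strong_induction_on with
    | _ n ih =>
      intro v hv hn hvy
      by_cases hvz : v = z
      · exact ⟨1, hvz ▸ .refl v⟩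
      · obtain ⟨b, hb, ⟨e, he, hc⟩, hlt⟩ := (hbet v hv hvy hvz).2
        have := hfz b hb
        obtain ⟨γ, hγ⟩ := ih (f z - f b) (by omega) b hb rfl
          (fun h => (hfy v hv).not_gt (h ▸ hlt))
        exact ⟨_, .step he hc hlt hγ⟩
  have huniq : ∀ v ∈ G.verts, v ≠ y → ∀ γ δ, G.Ascends f y v γ → G.Ascends f y v δ → γ = δ := by
    intro v hv hvy γ δ hγ hδ
    obtain ⟨ε, hε⟩ := hup _ v hv rfl hvy
    exact mul_left_cancel (hl (hγ.trans hε).mem_labelSet (hδ.trans hε).mem_labelSet)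
  have hφ' : ∃ φ : V → Γ, ∀ v γ, G.Ascends f y v γ → G.Ascends f y v (φ v) := by
    have : ∀ v, ∃ δ, ∀ γ, G.Ascends f y v γ → G.Ascends f y v δ := fun v => by
      by_cases h : ∃ γ, G.Ascends f y v γ
      · exact h.imp fun _ h _ _ => h
      · exact ⟨1, fun γ hγ => (h ⟨γ, hγ⟩).elim⟩
    exact ⟨_, fun v => (this v).choose_spec⟩
  obtain ⟨φ, hφ⟩ := hφ'
  have hstep : ∀ u v, ∀ a ∈ G.arcs, connects a u v → u ∈ G.verts → v ∈ G.verts → f u < f v →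
      φ v = stepLabel v a * φ u := by
    intro u v a ha hc hu hv hlt
    obtain ⟨γ, hγ⟩ := hdown _ u hu rfl (fun h => (hfz v hv).not_gt (h ▸ hlt))
    have hv' := (hφ u γ hγ).trans (.of_connects ha hc hlt)
    exact huniq v hv (fun h => (hfy u hu).not_gt (h ▸ hlt)) _ _ (hφ v _ hv') hv'
  refine ⟨φ, fun a ha => ?_⟩
  have hne := G.loopless a ha
  have ht := G.tail_mem a ha
  have hh := G.head_mem a ha
  rcases lt_or_gt_of_ne (fun h => hne (hinj ht hh h)) with hlt | hlt
  · simpa [stepLabel] using hstep _ _ a ha (.inl ⟨rfl, rfl⟩) ht hh hlt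
  · rw [hstep _ _ a ha (.inr ⟨rfl, rfl⟩) hh ht hlt]
    simp [stepLabel, hne.symm]

/-- A part of a 3-cut whose paths between two cut vertices avoiding the third all have the same
label carries a potential after deletion of that third vertex. -/
theorem exists_isPotential_around_delete {G : LGraph V Γ} {s t : V} {X : Set V} {x y z : V}
    (hD : G.MemD s t) (h2 : ∀ Y : Set V, ¬ G.TwoContractible s t Y)
    (hX : X ⊆ G.verts \ {s, t}) (hxy : x ≠ y) (hxz : x ≠ z) (hyz : y ≠ z)
    (hN : G.nbhd X = {x, y, z})
    (hl : (labelSet ((G.around X).delete {x}) y z).Subsingleton) :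
    ∃ φ, ((G.around X).delete {x}).IsPotential φ := by
  have hmem : ∀ v ∈ G.nbhd X, v ∈ G.verts := fun v ⟨_, u, _, a, ha, hc⟩ =>
    mem_verts_of_connects ha hc.symm
  have hyN : y ∈ G.nbhd X := by simp [hN]
  have hzN : z ∈ G.nbhd X := by simp [hN]
  refine exists_isPotential hyz ⟨⟨hmem y hyN, .inr hyN⟩, hxy.symm⟩ ⟨⟨hmem z hzN, .inr hzN⟩, hxz.symm⟩
    ?_ hl
  intro E hE hne hyE hzE w
  have hEX : E ⊆ X := by
    intro v hv
    obtain ⟨⟨-, h | h⟩, hvx⟩ := hE hv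
    · exact h
    · rw [hN] at h
      rcases h with h | rfl | rfl
      exacts [(hvx h).elim, (hyE hv).elim, (hzE hv).elim]
  obtain ⟨v, ⟨hvE, d, hd, a, ha, hc⟩, hvx, hvw⟩ := exists_nbhd_of_not_twoContractible hD h2
    (hEX.trans hX) hne hyz hxy hxz (hmem y hyN) (hmem z hzN) hyE hzE w
  have hdx : d ≠ x := (hE hd).2
  have ha' := mem_around_arcs ha hc (hEX hd)
  refine ⟨d, hd, v, ⟨mem_verts_of_connects ha' hc.symm, hvx⟩, hvE, hvw, a, ⟨ha', ?_⟩, hc⟩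
  rcases hc with ⟨rfl, rfl⟩ | ⟨rfl, rfl⟩
  · exact ⟨hdx, hvx⟩
  · exact ⟨hvx, hdx⟩

/-- If two of the three path label sets across a 3-cut are trivial, the cut part is balanced. -/
theorem around_balanced_of_subsingleton {G : LGraph V Γ} {s t : V} {X : Set V} {x y z : V}
    (hD : G.MemD s t) (h2 : ∀ Y : Set V, ¬ G.TwoContractible s t Y)
    (hX : X ⊆ G.verts \ {s, t}) (hxy : x ≠ y) (hxz : x ≠ z) (hyz : y ≠ z)
    (hN : G.nbhd X = {x, y, z}) (hconn : (G.induce X).Connected)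
    (hlx : (labelSet ((G.around X).delete {x}) y z).Subsingleton)
    (hly : (labelSet ((G.around X).delete {y}) z x).Subsingleton) : (G.around X).Balanced := by
  obtain ⟨φ, hφ⟩ := exists_isPotential_around_delete hD h2 hX hxy hxz hyz hN hlx
  obtain ⟨ψ, hψ⟩ := exists_isPotential_around_delete hD h2 hX hyz hxy.symm hxz.symm
    (by rw [hN]; grind) hly
  have hxN : x ∈ G.nbhd X := by simp [hN]
  have hyN : y ∈ G.nbhd X := by simp [hN]
  obtain ⟨-, d, hd, -⟩ := id hxN
  have hsub : ∀ w ∈ G.nbhd X, (G.induce X).arcs ⊆ ((G.around X).delete {w}).arcs := by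
    rintro w hw a ⟨ha, ht, hh⟩
    exact ⟨mem_around_arcs ha (.inl ⟨rfl, rfl⟩) ht, fun h => hw.1 (h ▸ ht), fun h => hw.1 (h ▸ hh)⟩
  have hc : ∀ v ∈ X, φ v = ψ v * ((ψ d)⁻¹ * φ d) := by
    intro v hv
    have hj := hconn d ⟨(hX hd).1, hd⟩ v ⟨(hX hv).1, hv⟩
    rw [IsPotential.inv_mul_eq (fun a ha => hφ a (hsub x hxN ha))
      (fun a ha => hψ a (hsub y hyN ha)) hj]
    group
  refine IsPotential.balanced (φ := fun v => if v = x then ψ x * ((ψ d)⁻¹ * φ d) else φ v) ?_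
  intro a ha
  have hne := (G.around X).loopless a ha
  have hother : ∀ v ∈ X ∪ G.nbhd X, v ∉ G.nbhd X → v ∈ X := fun v h h' => h.resolve_right h'
  by_cases hh : a.2.1 = x
  · have ht : a.1 ∈ X := hother _ ha.2.1 fun h => ha.2.2.2 ⟨h, hh ▸ hxN⟩
    have := hψ a ⟨ha, fun h => hyN.1 (h ▸ ht), fun h => hxy (hh.symm.trans h)⟩
    simp only [hh, if_true, if_neg (hh ▸ hne)]
    rw [hc _ ht, ← hh, this, mul_assoc]
  · by_cases ht : a.1 = x
    · have hhX : a.2.1 ∈ X := hother _ ha.2.2.1 fun h => ha.2.2.2 ⟨ht ▸ hxN, h⟩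
      have := hψ a ⟨ha, fun h => hxy (ht.symm.trans h), fun h => hyN.1 (h ▸ hhX)⟩
      simp only [ht, if_true, if_neg hh]
      rw [hc _ hhX, this, ← ht, mul_assoc]
    · simp only [if_neg hh, if_neg ht]
      exact hφ a ⟨ha, ht, hh⟩

end LGraph

open LGraph in
/-- Let `(G, s, t) ∈ 𝒟` contain no 2-contractible and no
3-contractible vertex set, and let `X ⊆ V(G)∖{s,t}` satisfy `N_G(X) = {x, y, z}`
(distinct) with `G[X]` connected.  Then at least two of
`|l(G⟦X⟧ − x; y, z)| ≥ 2`, `|l(G⟦X⟧ − y; z, x)| ≥ 2`, `|l(G⟦X⟧ − z; x, y)| ≥ 2`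
hold. -/
theorem threeCut_two_nontrivial {V Γ : Type} [Group Γ] [DecidableEq V]
    (G : LGraph V Γ) (s t : V) (X : Set V) (x y z : V)
    (hD : G.MemD s t)
    (h2 : ∀ Y : Set V, ¬ G.TwoContractible s t Y)
    (h3 : ∀ Y : Set V, ¬ G.ThreeContractible s t Y)
    (hX : X ⊆ G.verts \ {s, t})
    (hxy : x ≠ y) (hxz : x ≠ z) (hyz : y ≠ z)
    (hN : G.nbhd X = {x, y, z})
    (hconn : (G.induce X).Connected) :
    ((labelSet ((G.around X).delete {x}) y z).Nontrivial ∧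
       (labelSet ((G.around X).delete {y}) z x).Nontrivial) ∨
    ((labelSet ((G.around X).delete {y}) z x).Nontrivial ∧
       (labelSet ((G.around X).delete {z}) x y).Nontrivial) ∨
    ((labelSet ((G.around X).delete {x}) y z).Nontrivial ∧
       (labelSet ((G.around X).delete {z}) x y).Nontrivial) := by
  have hN₁ : G.nbhd X = {y, z, x} := by rw [hN]; grind
  have hN₂ : G.nbhd X = {z, x, y} := by rw [hN]; grind
  have hbal : ¬ (G.around X).Balanced := fun h =>
    h3 X ⟨hX, ⟨x, y, z, hxy, hxz, hyz, hN⟩, hconn, h⟩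
  have h₁ := mt (fun h : _ ∧ _ => around_balanced_of_subsingleton hD h2 hX hxy hxz hyz hN hconn
    h.1 h.2) hbal
  have h₂ := mt (fun h : _ ∧ _ => around_balanced_of_subsingleton hD h2 hX hyz hxy.symm hxz.symm
    hN₁ hconn h.1 h.2) hbal
  have h₃ := mt (fun h : _ ∧ _ => around_balanced_of_subsingleton hD h2 hX hxz.symm hyz.symm hxy
    hN₂ hconn h.1 h.2) hbal
  simp only [← Set.not_subsingleton_iff]
  tauto
end

section
/- Let G be a finite undirected graph and let s₁, t₁, s₂, t₂ be four distinct vertices of G. Let 𝔾 be the ℤ₃-labeled graph obtained from G by replacing every edge by an arc with label 0 and adding one arc from t₁ to s₂ with label 1, and set s := s₁ and t := t₂. Then G contains two vertex-disjoint paths P₁ and P₂, where Pᵢ connects sᵢ and tᵢ for i = 1, 2, if and only if 𝔾 contains an s–t path of label 1. -/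
/-- The ℤ₃-labeled graph obtained from a finite simple graph `G` by replacing every
edge by an arc with label `0` and adding one arc from `t₁` to `s₂` with label `1`
(written multiplicatively: identity resp. `ofAdd 1`). -/
def z3Graph {V : Type} [Fintype V] [DecidableEq V] (G : SimpleGraph V)
    (t₁ s₂ : V) (h : t₁ ≠ s₂) : LGraph V (Multiplicative (ZMod 3)) where
  verts := Set.univ
  arcs := {p | G.Adj p.1 p.2.1 ∧ p.2.2 = 1} ∪
    {(t₁, s₂, Multiplicative.ofAdd (1 : ZMod 3))}
  verts_finite := Set.finite_univ
  arcs_finite := Set.toFinite _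
  tail_mem := fun _ _ => trivial
  head_mem := fun _ _ => trivial
  loopless := by
    intro a ha
    rcases ha with ⟨hadj, -⟩ | ha
    · exact hadj.ne
    · rw [Set.mem_singleton_iff] at ha; subst ha; exact h

namespace LGraph

theorem Walk.start_mem_support_s15 {V Γ : Type} [Group Γ] {H : LGraph V Γ} {u w : V}
    (Q : H.Walk u w) : u ∈ Q.support := by
  cases Q <;> simp [Walk.support]

theorem stepLabel_of_label_eq_one {V Γ : Type} [DecidableEq V] [Group Γ] (v : V)
    {a : V × V × Γ} (ha : a.2.2 = 1) : stepLabel v a = 1 := by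
  simp [stepLabel, ha]

theorem adj_of_connects {V Γ : Type} {G : SimpleGraph V} {a : V × V × Γ} {u v : V}
    (ha : G.Adj a.1 a.2.1) (hc : connects a u v) : G.Adj u v := by
  rcases hc with ⟨rfl, rfl⟩ | ⟨rfl, rfl⟩
  exacts [ha, ha.symm]

variable {V : Type} [Fintype V] [DecidableEq V] {G : SimpleGraph V} {t₁ s₂ : V} {h : t₁ ≠ s₂}

/-- A walk of `G` is a walk of trivial label in the labeled graph. -/
theorem exists_z3Walk_of_walk {u w : V} (p : G.Walk u w) :
    ∃ R : (z3Graph G t₁ s₂ h).Walk u w, R.support = p.support ∧ R.label = 1 := by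
  induction p with
  | nil => exact ⟨.nil _, rfl, rfl⟩
  | @cons u v w hadj p ih =>
    obtain ⟨R, hs, hl⟩ := ih
    refine ⟨.cons u v (u, v, 1) (Or.inl ⟨hadj, rfl⟩) (Or.inl ⟨rfl, rfl⟩) R, ?_, ?_⟩
    · simp [Walk.support, hs]
    · simp [Walk.label, stepLabel, hl]

/-- A walk of `G` ending in `t₁` can be joined through the arc `t₁ s₂` to a walk starting in
`s₂`. -/
theorem exists_z3Walk_join {u w : V} (p : G.Walk u t₁) (Q : (z3Graph G t₁ s₂ h).Walk s₂ w) :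
    ∃ R : (z3Graph G t₁ s₂ h).Walk u w, R.support = p.support ++ Q.support ∧
      R.label = Q.label * Multiplicative.ofAdd (1 : ZMod 3) := by
  induction p with
  | nil =>
    exact ⟨.cons _ s₂ (_, s₂, Multiplicative.ofAdd 1) (Or.inr rfl) (Or.inl ⟨rfl, rfl⟩) Q,
      by simp [Walk.support], by simp [Walk.label, stepLabel]⟩
  | @cons u v w hadj p ih =>
    obtain ⟨R, hs, hl⟩ := ih (h := h) Q
    refine ⟨.cons u v (u, v, 1) (Or.inl ⟨hadj, rfl⟩) (Or.inl ⟨rfl, rfl⟩) R, ?_, ?_⟩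
    · simp [Walk.support, hs]
    · simp [Walk.label, stepLabel, hl]

/-- A walk of the labeled graph missing an end of the added arc is a walk of `G` and has trivial
label. -/
theorem exists_walk_of_notMem_support {u w : V} (Q : (z3Graph G t₁ s₂ h).Walk u w)
    (hQ : t₁ ∉ Q.support ∨ s₂ ∉ Q.support) :
    Q.label = 1 ∧ ∃ p : G.Walk u w, p.support = Q.support := by
  induction Q with
  | nil v => exact ⟨rfl, .nil, rfl⟩
  | cons u v a ha hc W ih =>
    simp only [Walk.support, List.mem_cons, not_or] at hQ
    obtain ⟨hl, p, hp⟩ := ih (hQ.imp And.right And.right)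
    rcases ha with ⟨hadj, ha⟩ | rfl
    · exact ⟨by simp [Walk.label, hl, stepLabel_of_label_eq_one v ha],
        .cons (adj_of_connects hadj hc) p, by simp [Walk.support, hp]⟩
    · have hv := W.start_mem_support_s15
      rcases hc with ⟨rfl, rfl⟩ | ⟨rfl, rfl⟩ <;> simp_all

/-- A path of label `1` in the labeled graph splits at the added arc. -/
theorem Walk.IsPath.exists_walks_of_label {u w : V} {Q : (z3Graph G t₁ s₂ h).Walk u w}
    (hQ : Q.IsPath) (hl : Q.label = Multiplicative.ofAdd (1 : ZMod 3)) :
    ∃ (p : G.Walk u t₁) (q : G.Walk s₂ w), Q.support = p.support ++ q.support := by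
  induction Q with
  | nil v => exact absurd hl (by decide : (1 : Multiplicative (ZMod 3)) ≠ Multiplicative.ofAdd 1)
  | cons u v a ha hc W ih =>
    obtain ⟨hu, hW⟩ := List.nodup_cons.mp hQ
    rw [Walk.label] at hl
    rcases ha with ⟨hadj, ha⟩ | rfl
    · rw [stepLabel_of_label_eq_one v ha, mul_one] at hl
      obtain ⟨p, q, hpq⟩ := ih hW hl
      exact ⟨.cons (adj_of_connects hadj hc) p, q, by simp [Walk.support, hpq]⟩
    · rcases hc with ⟨rfl, rfl⟩ | ⟨rfl, rfl⟩
      · obtain ⟨-, q, hq⟩ := exists_walk_of_notMem_support W (Or.inl hu)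
        exact ⟨.nil, q, by simp [Walk.support, hq]⟩
      · rw [(exists_walk_of_notMem_support W (Or.inr hu)).1, stepLabel, if_neg h.symm] at hl
        exact absurd hl (by decide :
          (1 : Multiplicative (ZMod 3)) * (Multiplicative.ofAdd 1)⁻¹ ≠ Multiplicative.ofAdd 1)

end LGraph

open LGraph in
/-- `G` has two vertex-disjoint paths `P₁ : s₁–t₁` and `P₂ : s₂–t₂`
iff the associated ℤ₃-labeled graph has an `s₁`–`t₂` path of label `1` (additively). -/
theorem two_disjoint_paths_iff_label_one_path {V : Type} [Fintype V] [DecidableEq V]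
    (G : SimpleGraph V) (s₁ t₁ s₂ t₂ : V)
    (h₁ : s₁ ≠ t₁) (h₂ : s₁ ≠ s₂) (h₃ : s₁ ≠ t₂) (h₄ : t₁ ≠ s₂) (h₅ : t₁ ≠ t₂)
    (h₆ : s₂ ≠ t₂) :
    (∃ (P₁ : G.Walk s₁ t₁) (P₂ : G.Walk s₂ t₂), P₁.IsPath ∧ P₂.IsPath ∧
        ∀ v, v ∈ P₁.support → v ∉ P₂.support) ↔
      (∃ Q : (z3Graph G t₁ s₂ h₄).Walk s₁ t₂, Q.IsPath ∧
        Q.label = Multiplicative.ofAdd (1 : ZMod 3)) := by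
  constructor
  · rintro ⟨P₁, P₂, hP₁, hP₂, hdisj⟩
    obtain ⟨Q, hQs, hQl⟩ := exists_z3Walk_of_walk (h := h₄) P₂
    obtain ⟨R, hRs, hRl⟩ := exists_z3Walk_join P₁ Q
    refine ⟨R, ?_, by rw [hRl, hQl, one_mul]⟩
    rw [Walk.IsPath, hRs, hQs]
    exact hP₁.support_nodup.append hP₂.support_nodup hdisj
  · rintro ⟨Q, hQ, hl⟩
    obtain ⟨p, q, hpq⟩ := hQ.exists_walks_of_label hl
    rw [Walk.IsPath, hpq, List.nodup_append'] at hQ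
    exact ⟨p, q, .mk' hQ.1, .mk' hQ.2.1, fun _ hv => hQ.2.2 hv⟩
end

section
/- Let Γ be a group and let α, β ∈ Γ be distinct elements with αβ⁻¹ = βα⁻¹. Let 𝔾' = (G⃗, ψ') be a Γ-labeled graph with a vertex s such that every arc incident to s leaves s with label in {α, β}, and every arc not incident to s has label in {1_Γ, αβ⁻¹}. Then every path in 𝔾' of length at least 1 starting at s has label α or β. -/
namespace LGraph

variable {V Γ : Type} [Group Γ]

theorem Walk.start_mem_support_s16 {G : LGraph V Γ} {u w : V} (W : G.Walk u w) :
    u ∈ W.support := by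
  cases W <;> simp [Walk.support]

/-- The label of a walk avoiding `s` lies in any subgroup containing the labels of all arcs
not incident to `s`. -/
theorem Walk.label_mem_of_notMem_support [DecidableEq V] {G : LGraph V Γ} {s : V}
    {H : Subgroup Γ} (hH : ∀ a ∈ G.arcs, ¬ (a.1 = s ∨ a.2.1 = s) → a.2.2 ∈ H)
    {u w : V} (W : G.Walk u w)
    (hW : s ∉ W.support) : W.label ∈ H := by
  induction W with
  | nil v => exact H.one_mem
  | cons u v a ha hstep W ih =>
    simp only [Walk.support, List.mem_cons, not_or] at hW
    have hv : s ≠ v := fun h => hW.2 (h ▸ W.start_mem_support_s16)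
    have hlabel : a.2.2 ∈ H := by
      refine hH a ha ?_
      rcases hstep with ⟨h₁, h₂⟩ | ⟨h₁, h₂⟩ <;> rw [h₁, h₂] <;> tauto
    refine H.mul_mem (ih hW.2) ?_
    unfold stepLabel
    split_ifs
    exacts [hlabel, H.inv_mem hlabel]

end LGraph

open LGraph in
/-- Let `α ≠ β` with `αβ⁻¹ = βα⁻¹`.  If in `G'` every arc incident to
`s` leaves `s` with label in `{α, β}`, and every other arc has label in `{1, αβ⁻¹}`,
then every path of length at least 1 starting at `s` has label `α` or `β`. -/
theorem path_label_mem_two_of_comm {V Γ : Type} [Group Γ] [DecidableEq V]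
    (G' : LGraph V Γ) (s : V) (α β : Γ)
    (hne : α ≠ β) (hcomm : α * β⁻¹ = β * α⁻¹)
    (hs_arcs : ∀ a ∈ G'.arcs, (a.1 = s ∨ a.2.1 = s) →
      a.1 = s ∧ a.2.2 ∈ ({α, β} : Set Γ))
    (hother : ∀ a ∈ G'.arcs, ¬ (a.1 = s ∨ a.2.1 = s) →
      a.2.2 ∈ ({1, α * β⁻¹} : Set Γ)) :
    ∀ (w : V) (P : G'.Walk s w), P.IsPath → 1 ≤ P.length →
      P.label ∈ ({α, β} : Set Γ) := by
  intro w P hP hlen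
  have hsq : (α * β⁻¹) ^ 2 = 1 := by
    rw [pow_two]
    nth_rewrite 2 [hcomm]
    group
  cases P with
  | nil => simp [Walk.length] at hlen
  | cons _ v a ha hstep W =>
    obtain ⟨hsW, -⟩ := List.nodup_cons.mp hP
    have hmem : W.label ∈ Subgroup.zpowers (α * β⁻¹) := by
      refine W.label_mem_of_notMem_support (fun b hb hbs => ?_) hsW
      rcases hother b hb hbs with h | h <;> rw [h]
      exacts [one_mem _, Subgroup.mem_zpowers _]
    have hW : W.label = 1 ∨ W.label = α * β⁻¹ := by
      obtain ⟨k, hk⟩ := Subgroup.mem_zpowers_iff.mp hmem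
      rw [← hk]
      rcases Int.even_or_odd' k with ⟨m, rfl | rfl⟩
      · left
        rw [zpow_mul, zpow_ofNat, hsq, one_zpow]
      · right
        rw [zpow_add_one, zpow_mul, zpow_ofNat, hsq, one_zpow, one_mul]
    have hinc : a.1 = s ∨ a.2.1 = s := hstep.imp And.left And.right
    obtain ⟨htail, hlabel⟩ := hs_arcs a ha hinc
    have hhead : a.2.1 = v := by
      rcases hstep with h | h
      · exact h.2
      · exact absurd (htail.trans h.2.symm) (G'.loopless a ha)
    simp only [Walk.label, stepLabel, if_pos hhead]
    rcases hW with h | h <;> rcases hlabel with h' | h' <;> rw [h, h']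
    · simp
    · simp
    · right
      rw [hcomm]
      simp
    · simp
end
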